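/- Let φ be the unique classical solution of the terminal value problem (P) of at most linear growth. Then for every (t,s,i,y) ∈ D the partial derivative ∂φ/∂s admits the integral representation ∂φ/∂s(t,s,i,y) = [(1 − F(T−t+y|i))/(1 − F(y|i))]·∂ρ_i/∂s(t,s) + ∫_0^{T−t} e^{−r(i)v}·[f(y+v|i)/(1 − F(y|i))]·Σ_{j≠i} p_{ij}(y+v)·∫_0^∞ φ(t+v,x,j,0)·α(x;t,s,i,v)·L(t,x,s,i,v)/(s·σ̄(t,i,v)) dx dv. (In particular the optimal hedge ratio, which equals ∂φ/∂s, can be computed by numerical integration rather than numerical differentiation.) -/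

import Mathlib

open MeasureTheory Real Filter Set

noncomputable def sumLam {k : ℕ} (lam : Fin k → Fin k → ℝ → ℝ) (i : Fin k) (y : ℝ) : ℝ :=
  ∑ j ∈ Finset.univ.filter (fun j => j ≠ i), lam i j y

noncomputable def Lambda {k : ℕ} (lam : Fin k → Fin k → ℝ → ℝ) (i : Fin k) (y : ℝ) : ℝ :=
  ∫ v in (0:ℝ)..y, sumLam lam i v

noncomputable def Fcdf {k : ℕ} (lam : Fin k → Fin k → ℝ → ℝ) (i : Fin k) (y : ℝ) : ℝ :=
  1 - Real.exp (-(Lambda lam i y))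

noncomputable def fdens {k : ℕ} (lam : Fin k → Fin k → ℝ → ℝ) (i : Fin k) (y : ℝ) : ℝ :=
  sumLam lam i y * Real.exp (-(Lambda lam i y))

noncomputable def pMat {k : ℕ} (lam : Fin k → Fin k → ℝ → ℝ) (i j : Fin k) (y : ℝ) : ℝ :=
  if j = i then (if sumLam lam i y = 0 then 1 else 0)
  else (if sumLam lam i y = 0 then 0 else lam i j y / sumLam lam i y)

noncomputable def sigbar {k : ℕ} (σ : ℝ → Fin k → ℝ) (t : ℝ) (i : Fin k) (v : ℝ) : ℝ :=
  Real.sqrt (∫ u in t..(t+v), (σ u i)^2)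

noncomputable def Lfun {k : ℕ} (r : Fin k → ℝ) (σ : ℝ → Fin k → ℝ)
    (t x s : ℝ) (i : Fin k) (v : ℝ) : ℝ :=
  (Real.log (x / s) - ∫ u in t..(t+v), (r i - (σ u i)^2 / 2)) / sigbar σ t i v

noncomputable def alphaDens {k : ℕ} (r : Fin k → ℝ) (σ : ℝ → Fin k → ℝ)
    (x t s : ℝ) (i : Fin k) (v : ℝ) : ℝ :=
  Real.exp (-(Lfun r σ t x s i v)^2 / 2) / (Real.sqrt (2 * Real.pi) * x * sigbar σ t i v)

def memDbar (T t s y : ℝ) : Prop :=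
  t ∈ Set.Icc 0 T ∧ s ∈ Set.Ici (0:ℝ) ∧ y ∈ Set.Icc 0 t

def memD (T t s y : ℝ) : Prop :=
  t ∈ Set.Ioo 0 T ∧ s ∈ Set.Ioi (0:ℝ) ∧ y ∈ Set.Ioo 0 t

noncomputable def Aop {k : ℕ} (lam : Fin k → Fin k → ℝ → ℝ) (r : Fin k → ℝ)
    (σ : ℝ → Fin k → ℝ) (ρ : Fin k → ℝ → ℝ → ℝ) (T : ℝ)
    (φ : ℝ → ℝ → Fin k → ℝ → ℝ) (t s : ℝ) (i : Fin k) (y : ℝ) : ℝ :=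
  (1 - Fcdf lam i (T - t + y)) / (1 - Fcdf lam i y) * ρ i t s
  + ∫ v in (0:ℝ)..(T - t),
      Real.exp (-(r i * v)) * (fdens lam i (y + v) / (1 - Fcdf lam i y)) *
      ∑ j ∈ Finset.univ.filter (fun j => j ≠ i),
        pMat lam i j (y + v) *
        ∫ x in Set.Ioi (0:ℝ), φ (t + v) x j 0 * alphaDens r σ x t s i v

def memB {k : ℕ} (T : ℝ) (φ : ℝ → ℝ → Fin k → ℝ → ℝ) : Prop :=
  (∀ i : Fin k, ContinuousOn (fun p : ℝ × ℝ × ℝ => φ p.1 p.2.1 i p.2.2)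
      {p : ℝ × ℝ × ℝ | memDbar T p.1 p.2.1 p.2.2}) ∧
  ∃ M : ℝ, ∀ t s y : ℝ, memDbar T t s y → ∀ i : Fin k, |φ t s i y| ≤ M * (1 + s)

noncomputable def normB {k : ℕ} (T : ℝ) (φ : ℝ → ℝ → Fin k → ℝ → ℝ) : ℝ :=
  sSup {a : ℝ | ∃ t s y : ℝ, ∃ i : Fin k, memDbar T t s y ∧ a = |φ t s i y| / (1 + s)}

def isBSMSolution {k : ℕ} (r : Fin k → ℝ) (σ : ℝ → Fin k → ℝ) (K : ℝ → ℝ) (T : ℝ)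
    (ρ : Fin k → ℝ → ℝ → ℝ) : Prop :=
  ∀ i : Fin k,
    ContinuousOn (fun p : ℝ × ℝ => ρ i p.1 p.2) (Set.Icc 0 T ×ˢ Set.Ici 0) ∧
    (∀ t ∈ Set.Icc (0:ℝ) T, ∀ s ∈ Set.Ici (0:ℝ), 0 ≤ ρ i t s) ∧
    (∃ M : ℝ, ∀ t ∈ Set.Icc (0:ℝ) T, ∀ s ∈ Set.Ici (0:ℝ), ρ i t s ≤ M * (1 + s)) ∧
    (∀ t ∈ Set.Ioo (0:ℝ) T, ∀ s ∈ Set.Ioi (0:ℝ),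
      (DifferentiableAt ℝ (fun u => ρ i u s) t ∧
       DifferentiableAt ℝ (fun x => ρ i t x) s ∧
       DifferentiableAt ℝ (deriv (fun x => ρ i t x)) s) ∧
      deriv (fun u => ρ i u s) t + r i * s * deriv (fun x => ρ i t x) s
        + (1/2) * (σ t i)^2 * s^2 * deriv (deriv (fun x => ρ i t x)) s
        = r i * ρ i t s) ∧
    (∀ s ∈ Set.Ici (0:ℝ), ρ i T s = K s)


noncomputable def ptilde {k : ℕ} (lam : Fin k → Fin k → ℝ → ℝ) :
    Matrix (Fin k) (Fin k) ℝ :=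
  Matrix.of fun i j => ∫ y in Set.Ioi (0:ℝ), pMat lam i j y * fdens lam i y

/-- `ℓ` is the value at `(t, z, y)` of the operator `∂ₜ + ∂_y + m ∂_z + q ∂²_z` applied to `W`,
all the partial derivatives involved being assumed to exist. -/
def HasGenAt (m q : ℝ) (W : ℝ → ℝ → ℝ → ℝ) (t z y ℓ : ℝ) : Prop :=
  ∃ (wt wy w2 : ℝ) (wz : ℝ → ℝ),
    HasDerivAt (fun u => W u z y) wt t ∧ HasDerivAt (fun w => W t z w) wy y ∧
    (∀ᶠ x in nhds z, HasDerivAt (fun x => W t x y) (wz x) x) ∧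
    HasDerivAt wz w2 z ∧ wt + wy + m * wz z + q * w2 = ℓ

namespace HasGenAt

variable {m q t z y ℓ ℓ' : ℝ} {W W' : ℝ → ℝ → ℝ → ℝ}

theorem add (h : HasGenAt m q W t z y ℓ) (h' : HasGenAt m q W' t z y ℓ') :
    HasGenAt m q (fun t z y => W t z y + W' t z y) t z y (ℓ + ℓ') := by
  obtain ⟨a, b, c, d, h1, h2, h3, h4, h5⟩ := h
  obtain ⟨a', b', c', d', h1', h2', h3', h4', h5'⟩ := h'
  refine ⟨a + a', b + b', c + c', fun x => d x + d' x, h1.add h1', h2.add h2', ?_, h4.add h4', ?_⟩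
  · filter_upwards [h3, h3'] with x hx hx' using hx.add hx'
  · rw [← h5, ← h5']; ring

theorem const_mul (k : ℝ) (h : HasGenAt m q W t z y ℓ) :
    HasGenAt m q (fun t z y => k * W t z y) t z y (k * ℓ) := by
  obtain ⟨a, b, c, d, h1, h2, h3, h4, h5⟩ := h
  refine ⟨k * a, k * b, k * c, fun x => k * d x, h1.const_mul k, h2.const_mul k, ?_,
    h4.const_mul k, ?_⟩
  · filter_upwards [h3] with x hx using hx.const_mul k
  · rw [← h5]; ring

theorem congr_val (h : HasGenAt m q W t z y ℓ) (e : ℓ = ℓ') : HasGenAt m q W t z y ℓ' := e ▸ h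

theorem neg (h : HasGenAt m q W t z y ℓ) :
    HasGenAt m q (fun t z y => - W t z y) t z y (-ℓ) := by
  simpa using h.const_mul (-1)

theorem sub (h : HasGenAt m q W t z y ℓ) (h' : HasGenAt m q W' t z y ℓ') :
    HasGenAt m q (fun t z y => W t z y - W' t z y) t z y (ℓ - ℓ') := by
  simpa [sub_eq_add_neg] using h.add h'.neg

end HasGenAt

theorem IsLocalMax.second_deriv_nonpos {f f' : ℝ → ℝ} {x f'' : ℝ} (hmax : IsLocalMax f x)
    (hf : ∀ᶠ u in nhds x, HasDerivAt f (f' u) u) (hf' : HasDerivAt f' f'' x) : f'' ≤ 0 := by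
  by_contra! hpos
  have hd : deriv f =ᶠ[nhds x] f' := by
    filter_upwards [hf] with u hu using hu.deriv
  have hdd : deriv (deriv f) x = f'' := by
    rw [hd.deriv_eq, hf'.deriv]
  have h0 : deriv f x = 0 := hmax.deriv_eq_zero
  have hmin := isLocalMin_of_deriv_deriv_pos (by rw [hdd]; exact hpos) h0
    hf.self_of_nhds.continuousAt
  have hconst : f =ᶠ[nhds x] fun _ => f x := by
    filter_upwards [hmax, hmin] with u h1 h2 using le_antisymm h1 h2
  have hz : deriv (deriv f) x = 0 := by
    rw [hconst.deriv.deriv_eq]; simp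
  linarith

theorem HasGenAt.nonpos_of_isLocalMax {m q t z y ℓ : ℝ} {W : ℝ → ℝ → ℝ → ℝ}
    (h : HasGenAt m q W t z y ℓ) (hq : 0 ≤ q)
    (hmax : IsLocalMax (fun p : ℝ × ℝ × ℝ => W p.1 p.2.1 p.2.2) (t, z, y)) : ℓ ≤ 0 := by
  obtain ⟨a, b, c, d, h1, h2, h3, h4, h5⟩ := h
  have m1 : IsLocalMax (fun u => W u z y) t :=
    (Continuous.continuousAt (f := fun u : ℝ => (u, z, y)) (by fun_prop)).eventually hmax
  have m2 : IsLocalMax (fun w => W t z w) y :=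
    (Continuous.continuousAt (f := fun u : ℝ => (t, z, u)) (by fun_prop)).eventually hmax
  have m3 : IsLocalMax (fun x => W t x y) z :=
    (Continuous.continuousAt (f := fun u : ℝ => (t, u, y)) (by fun_prop)).eventually hmax
  have e1 := m1.hasDerivAt_eq_zero h1
  have e2 := m2.hasDerivAt_eq_zero h2
  have e3 := m3.hasDerivAt_eq_zero h3.self_of_nhds
  have e4 := m3.second_deriv_nonpos h3 h4
  rw [← h5, e1, e2, e3]
  nlinarith

theorem tube_maximum_principle {m q : ℝ → ℝ} {W : ℝ → ℝ → ℝ → ℝ} {t₁ T a η Z : ℝ}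
    (hq : ∀ t, 0 ≤ q t)
    (hW : ContinuousOn (fun p : ℝ × ℝ × ℝ => W p.1 p.2.1 p.2.2)
      {p | p.1 ∈ Icc t₁ T ∧ |p.2.1| ≤ Z ∧ |p.1 - p.2.2 - a| ≤ η})
    (hstart : ∀ z y, |z| ≤ Z → |t₁ - y - a| ≤ η → W t₁ z y ≤ 0)
    (hterm : ∀ z y, |z| ≤ Z → |T - y - a| ≤ η → W T z y ≤ 0)
    (hside : ∀ t z y, t ∈ Icc t₁ T → |z| = Z → |t - y - a| ≤ η → W t z y ≤ 0)
    (hedge : ∀ t z y, t ∈ Icc t₁ T → |z| ≤ Z → |t - y - a| = η → W t z y ≤ 0)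
    (hgen : ∀ t z y, t ∈ Ioo t₁ T → |z| < Z → |t - y - a| < η →
      ∃ ℓ, 0 < ℓ ∧ HasGenAt (m t) (q t) W t z y ℓ)
    {t z y : ℝ} (ht : t ∈ Icc t₁ T) (hz : |z| ≤ Z) (hy : |t - y - a| ≤ η) : W t z y ≤ 0 := by
  set S : Set (ℝ × ℝ × ℝ) := {p | p.1 ∈ Icc t₁ T ∧ |p.2.1| ≤ Z ∧ |p.1 - p.2.2 - a| ≤ η} with hS
  have hcl : IsClosed S := by
    refine (isClosed_Icc.preimage continuous_fst).inter (IsClosed.inter ?_ ?_)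
    · exact isClosed_le (f := fun p : ℝ × ℝ × ℝ => |p.2.1|) (g := fun _ => Z)
        (by fun_prop) continuous_const
    · exact isClosed_le (f := fun p : ℝ × ℝ × ℝ => |p.1 - p.2.2 - a|) (g := fun _ => η)
        (by fun_prop) continuous_const
  have hcpt : IsCompact S := by
    refine (isCompact_Icc (a := t₁) (b := T)).prod ((isCompact_Icc (a := -Z) (b := Z)).prod
      (isCompact_Icc (a := t₁ - a - η) (b := T - a + η))) |>.of_isClosed_subset hcl ?_
    rintro ⟨u, x, w⟩ ⟨h1, h2, h3⟩
    simp only [mem_Icc, abs_le] at h1 h2 h3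
    simp only [mem_prod, mem_Icc]
    refine ⟨h1, h2, ?_, ?_⟩ <;> linarith [h1.1, h1.2, h3.1, h3.2]
  obtain ⟨⟨u, x, w⟩, hp, hmax⟩ := hcpt.exists_isMaxOn ⟨(t, z, y), ht, hz, hy⟩ hW
  refine (hmax (show (t, z, y) ∈ S from ⟨ht, hz, hy⟩)).trans ?_
  obtain ⟨hu, hx, hw⟩ := hp
  simp only at hu hx hw ⊢
  rcases hx.eq_or_lt with hx' | hx'
  · exact hside u x w hu hx' hw
  rcases hw.eq_or_lt with hw' | hw'
  · exact hedge u x w hu hx hw'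
  rcases hu.1.eq_or_lt with hu' | hu'
  · subst hu'; exact hstart x w hx hw
  rcases hu.2.eq_or_lt with hu'' | hu''
  · subst hu''; exact hterm x w hx hw
  obtain ⟨ℓ, hℓ, hg⟩ := hgen u x w ⟨hu', hu''⟩ hx' hw'
  have hnhds : S ∈ nhds (u, x, w) := by
    have o1 : IsOpen {p : ℝ × ℝ × ℝ | p.1 ∈ Ioo t₁ T ∧ |p.2.1| < Z ∧ |p.1 - p.2.2 - a| < η} := by
      refine (isOpen_Ioo.preimage continuous_fst).inter (IsOpen.inter ?_ ?_)
      · exact isOpen_lt (f := fun p : ℝ × ℝ × ℝ => |p.2.1|) (g := fun _ => Z)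
          (by fun_prop) continuous_const
      · exact isOpen_lt (f := fun p : ℝ × ℝ × ℝ => |p.1 - p.2.2 - a|) (g := fun _ => η)
          (by fun_prop) continuous_const
    refine mem_of_superset (o1.mem_nhds ⟨⟨hu', hu''⟩, hx', hw'⟩) ?_
    rintro p ⟨h1, h2, h3⟩
    exact ⟨Ioo_subset_Icc_self h1, h2.le, h3.le⟩
  exact absurd (hg.nonpos_of_isLocalMax (hq u) (hmax.isLocalMax hnhds)) (not_le.2 hℓ)

/-- The weight `e^{2z} + e^{-2z}`. -/
noncomputable def expWeight (z : ℝ) : ℝ := exp (2 * z) + exp (-(2 * z))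

theorem two_le_expWeight (z : ℝ) : 2 ≤ expWeight z := by
  have h : exp (2 * z) * exp (-(2 * z)) = 1 := by rw [← exp_add]; simp
  unfold expWeight
  nlinarith [sq_nonneg (exp (2 * z) - exp (-(2 * z))), exp_pos (2 * z), exp_pos (-(2 * z))]

theorem expWeight_pos (z : ℝ) : 0 < expWeight z := by linarith [two_le_expWeight z]

theorem continuous_expWeight : Continuous expWeight := by unfold expWeight; fun_prop

theorem exp_two_abs_le_expWeight (z : ℝ) : exp (2 * |z|) ≤ expWeight z := by
  unfold expWeight
  rcases abs_cases z with h | h <;> rw [h.1]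
  · linarith [exp_pos (-(2 * z))]
  · rw [mul_neg]; linarith [exp_pos (2 * z)]

theorem expWeight_le_exp_abs (z : ℝ) : expWeight z ≤ 2 * exp (2 * |z|) := by
  unfold expWeight
  have h1 : exp (2 * z) ≤ exp (2 * |z|) := exp_le_exp.2 (by linarith [le_abs_self z])
  have h2 : exp (-(2 * z)) ≤ exp (2 * |z|) := exp_le_exp.2 (by linarith [neg_abs_le z])
  linarith

theorem expWeight_add_mul_le {x s X S ξ : ℝ} (hx : |x| ≤ X) (hs : |s| ≤ S) :
    expWeight (x + s * ξ) ≤ 2 * exp (2 * X) * expWeight (S * ξ) := by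
  have hS : 0 ≤ S := (abs_nonneg s).trans hs
  calc expWeight (x + s * ξ) ≤ 2 * exp (2 * |x + s * ξ|) := expWeight_le_exp_abs _
    _ ≤ 2 * exp (2 * X + 2 * |S * ξ|) := by
        gcongr
        have h1 := abs_add_le x (s * ξ)
        have h2 : |s * ξ| ≤ |S * ξ| := by
          rw [abs_mul, abs_mul]
          exact mul_le_mul_of_nonneg_right (hs.trans (le_abs_self S)) (abs_nonneg ξ)
        linarith
    _ = 2 * exp (2 * X) * exp (2 * |S * ξ|) := by rw [exp_add]; ring
    _ ≤ _ := by gcongr; exact exp_two_abs_le_expWeight _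

theorem abs_mul_expWeight_le (S ξ : ℝ) :
    |ξ| * expWeight (S * ξ) ≤ expWeight ((S + 1) * ξ) + expWeight ((S - 1) * ξ) := by
  have h1 : |ξ| ≤ expWeight ξ := by
    have := add_one_le_exp (2 * |ξ|)
    linarith [exp_two_abs_le_expWeight ξ, abs_nonneg ξ]
  have h2 : expWeight ξ * expWeight (S * ξ)
      = expWeight ((S + 1) * ξ) + expWeight ((S - 1) * ξ) := by
    unfold expWeight
    rw [add_mul, mul_add, mul_add, ← exp_add, ← exp_add, ← exp_add, ← exp_add]
    ring_nf
  rw [← h2]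
  exact mul_le_mul_of_nonneg_right h1 (expWeight_pos _).le

theorem integrable_expWeight_gaussianReal (S : ℝ) :
    Integrable (fun ξ => expWeight (S * ξ)) (ProbabilityTheory.gaussianReal 0 1) := by
  have h1 := ProbabilityTheory.integrable_exp_mul_gaussianReal (μ := 0) (v := 1) (2 * S)
  have h2 := ProbabilityTheory.integrable_exp_mul_gaussianReal (μ := 0) (v := 1) (-(2 * S))
  refine (h1.add h2).congr (Eventually.of_forall fun ξ => ?_)
  simp only [expWeight, Pi.add_apply]
  ring_nf

theorem integrable_abs_mul_expWeight_gaussianReal (S : ℝ) :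
    Integrable (fun ξ => |ξ| * expWeight (S * ξ)) (ProbabilityTheory.gaussianReal 0 1) := by
  refine ((integrable_expWeight_gaussianReal (S + 1)).add
    (integrable_expWeight_gaussianReal (S - 1))).mono' ?_ (Eventually.of_forall fun ξ => ?_)
  · exact (continuous_abs.mul (continuous_expWeight.comp
      (continuous_const.mul continuous_id))).aestronglyMeasurable
  · rw [Real.norm_eq_abs, abs_of_nonneg (mul_nonneg (abs_nonneg _) (expWeight_pos _).le)]
    exact abs_mul_expWeight_le S ξ

theorem integral_cos_gaussianReal (ω c : ℝ) :
    ∫ ξ, cos (ω * ξ + c) ∂(ProbabilityTheory.gaussianReal 0 1)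
      = exp (-(ω ^ 2 / 2)) * cos c := by
  have h := ProbabilityTheory.charFun_gaussianReal (μ := 0) (v := 1) ω
  rw [charFun_apply_real] at h
  have hint : Integrable (fun ξ : ℝ => Complex.exp (ω * ξ * Complex.I) * Complex.exp (c * Complex.I))
      (ProbabilityTheory.gaussianReal 0 1) := by
    refine Integrable.of_bound (C := 1) (by fun_prop) (Eventually.of_forall fun ξ => ?_)
    rw [norm_mul, Complex.norm_exp_ofReal_mul_I, ← Complex.ofReal_mul,
      Complex.norm_exp_ofReal_mul_I, one_mul]
  have e1 : ∀ ξ : ℝ, cos (ω * ξ + c)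
      = (Complex.exp (ω * ξ * Complex.I) * Complex.exp (c * Complex.I)).re := by
    intro ξ
    rw [← Complex.exp_add, ← add_mul, ← Complex.ofReal_mul, ← Complex.ofReal_add,
      Complex.exp_ofReal_mul_I_re]
  simp_rw [e1]
  have h3 := integral_re hint
  simp only [RCLike.re_eq_complex_re] at h3
  rw [h3, integral_mul_const, h]
  have e2 : (ω * (0 : ℝ) * Complex.I - ((1 : NNReal) : ℝ) * (ω : ℂ) ^ 2 / 2 : ℂ)
      = ((-(ω ^ 2 / 2) : ℝ) : ℂ) := by
    push_cast; ring
  rw [e2, ← Complex.ofReal_exp, Complex.re_ofReal_mul, Complex.exp_ofReal_mul_I_re]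

/-- Finite sums of functions `a(u) cos(ω z + θ)` with continuous amplitudes `a`. -/
inductive IsTrigSum : (ℝ → ℝ → ℝ) → Prop
  | basic (a : ℝ → ℝ) (ha : Continuous a) (ω θ : ℝ) :
      IsTrigSum fun u z => a u * cos (ω * z + θ)
  | add {g h : ℝ → ℝ → ℝ} (hg : IsTrigSum g) (hh : IsTrigSum h) :
      IsTrigSum fun u z => g u z + h u z

namespace IsTrigSum

theorem mul {g h : ℝ → ℝ → ℝ} (hg : IsTrigSum g) (hh : IsTrigSum h) :
    IsTrigSum fun u z => g u z * h u z := by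
  induction hg with
  | add _ _ ih1 ih2 =>
    convert ih1.add ih2 using 3
    ring
  | basic a ha ω θ =>
    induction hh with
    | add _ _ ih1 ih2 =>
      convert ih1.add ih2 using 3
      ring
    | basic b hb ω' θ' =>
      convert (basic (fun u => a u * b u / 2) (by fun_prop) (ω + ω') (θ + θ')).add
        (basic (fun u => a u * b u / 2) (by fun_prop) (ω - ω') (θ - θ')) using 3 with u z
      rw [show (ω + ω') * z + (θ + θ') = (ω * z + θ) + (ω' * z + θ') by ring,
        show (ω - ω') * z + (θ - θ') = (ω * z + θ) - (ω' * z + θ') by ring, cos_add, cos_sub]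
      ring

theorem exists_near_comp_sin {Γ : ℝ → ℝ → ℝ} (hΓ : Continuous (fun p : ℝ × ℝ => Γ p.1 p.2))
    (t₁ T ω : ℝ) {ε : ℝ} (hε : 0 < ε) :
    ∃ g, IsTrigSum g ∧ ∀ u ∈ Icc t₁ T, ∀ z, |g u z - Γ u (sin (ω * z))| ≤ ε := by
  let c₁ : C(Icc t₁ T × Icc (-1 : ℝ) 1, ℝ) := ⟨fun p => (p.1 : ℝ), by fun_prop⟩
  let c₂ : C(Icc t₁ T × Icc (-1 : ℝ) 1, ℝ) := ⟨fun p => (p.2 : ℝ), by fun_prop⟩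
  let A : Subalgebra ℝ C(Icc t₁ T × Icc (-1 : ℝ) 1, ℝ) := Algebra.adjoin ℝ {c₁, c₂}
  have hsep : A.SeparatesPoints := by
    rintro ⟨u, x⟩ ⟨u', x'⟩ hne
    by_cases hu : u = u'
    · refine ⟨c₂, ⟨c₂, Algebra.subset_adjoin (by simp), rfl⟩, fun h => hne ?_⟩
      exact Prod.ext hu (Subtype.ext h)
    · refine ⟨c₁, ⟨c₁, Algebra.subset_adjoin (by simp), rfl⟩, fun h => hu ?_⟩
      exact Subtype.ext h
  obtain ⟨f, hf⟩ := ContinuousMap.exists_mem_subalgebra_near_continuous_of_separatesPoints A hsep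
    (fun p : Icc t₁ T × Icc (-1 : ℝ) 1 => Γ p.1 p.2)
    (hΓ.comp (f := fun p : Icc t₁ T × Icc (-1 : ℝ) 1 => ((p.1 : ℝ), (p.2 : ℝ))) (by fun_prop)) ε hε
  have key : ∀ f ∈ A, ∃ g, IsTrigSum g ∧ ∀ (u : Icc t₁ T) (z : ℝ),
      g u z = f (u, ⟨sin (ω * z), neg_one_le_sin _, sin_le_one _⟩) := by
    intro f hf
    induction hf using Algebra.adjoin_induction with
    | mem x hx =>
      rcases hx with rfl | rfl
      · exact ⟨_, basic (fun u => u) continuous_id 0 0, fun u z => by simp [c₁]⟩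
      · refine ⟨_, basic (fun _ => 1) continuous_const ω (-(π / 2)), fun u z => ?_⟩
        simp [c₂, ← sub_eq_add_neg, cos_sub_pi_div_two]
    | algebraMap r => exact ⟨_, basic (fun _ => r) continuous_const 0 0, fun u z => by simp⟩
    | add x y _ _ hx hy =>
      obtain ⟨g, hg, hg'⟩ := hx
      obtain ⟨h, hh, hh'⟩ := hy
      exact ⟨_, hg.add hh, fun u z => by simp [hg', hh']⟩
    | mul x y _ _ hx hy =>
      obtain ⟨g, hg, hg'⟩ := hx
      obtain ⟨h, hh, hh'⟩ := hy
      exact ⟨_, hg.mul hh, fun u z => by simp [hg', hh']⟩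
  obtain ⟨g, hg, hg'⟩ := key f f.2
  refine ⟨g, hg, fun u hu z => ?_⟩
  have := (hf (⟨u, hu⟩, ⟨sin (ω * z), neg_one_le_sin _, sin_le_one _⟩)).le
  rw [← hg'] at this
  exact this

theorem exists_near_of_growth {G : ℝ → ℝ → ℝ} (hG : Continuous (fun p : ℝ × ℝ => G p.1 p.2))
    {t₁ T C : ℝ} (hgrow : ∀ u ∈ Icc t₁ T, ∀ z, |G u z| ≤ C * exp |z|) {δ : ℝ} (hδ : 0 < δ) :
    ∃ g, IsTrigSum g ∧ ∀ u ∈ Icc t₁ T, ∀ z, |g u z - G u z| ≤ δ * expWeight z := by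
  wlog hC : 0 ≤ C generalizing C
  · refine this (C := 0) (fun u hu z => (hgrow u hu z).trans ?_) le_rfl
    exact mul_le_mul_of_nonneg_right (not_le.1 hC).le (exp_pos _).le
  set R : ℝ := 8 * C / δ + 1 with hR
  have hR0 : 0 < R := by positivity
  set ω : ℝ := π / 2 / R with hω
  have hω0 : 0 < ω := by positivity
  obtain ⟨g, hg, hg'⟩ := exists_near_comp_sin (Γ := fun u x => G u (arcsin x / ω))
    (hG.comp (f := fun p : ℝ × ℝ => (p.1, arcsin p.2 / ω))
      (continuous_fst.prodMk ((continuous_arcsin.comp continuous_snd).div_const ω)))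
    t₁ T ω (half_pos hδ)
  refine ⟨g, hg, fun u hu z => ?_⟩
  have h := hg' u hu z
  have hw := two_le_expWeight z
  by_cases hz : |z| ≤ R
  · have h1 : |ω * z| ≤ π / 2 := by
      rw [abs_mul, abs_of_pos hω0]
      calc ω * |z| ≤ ω * R := by gcongr
        _ = π / 2 := by rw [hω]; field_simp
    rw [arcsin_sin (abs_le.1 h1).1 (abs_le.1 h1).2, mul_div_cancel_left₀ _ hω0.ne'] at h
    nlinarith
  · push Not at hz
    have hx : |arcsin (sin (ω * z)) / ω| ≤ R := by
      rw [abs_div, abs_of_pos hω0, div_le_iff₀ hω0]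
      calc |arcsin (sin (ω * z))| ≤ π / 2 :=
            abs_le.2 ⟨neg_pi_div_two_le_arcsin _, arcsin_le_pi_div_two _⟩
        _ = R * ω := by rw [hω]; field_simp
    have h2 := hgrow u hu (arcsin (sin (ω * z)) / ω)
    have h3 := hgrow u hu z
    have h4 : C * exp |arcsin (sin (ω * z)) / ω| ≤ C * exp |z| :=
      mul_le_mul_of_nonneg_left (exp_le_exp.2 (hx.trans hz.le)) hC
    have h5 : 8 * C ≤ δ * exp |z| := by
      have : 8 * C / δ ≤ exp |z| := by linarith [add_one_le_exp |z|]
      rw [div_le_iff₀ hδ] at this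
      linarith
    have h6 : exp (2 * |z|) = exp |z| * exp |z| := by rw [← exp_add]; ring_nf
    have h7 := exp_two_abs_le_expWeight z
    have h8 : 8 * C * exp |z| ≤ δ * expWeight z := by
      calc 8 * C * exp |z| ≤ δ * exp |z| * exp |z| := by gcongr
        _ = δ * exp (2 * |z|) := by rw [h6]; ring
        _ ≤ _ := by gcongr
    rw [abs_le] at *
    constructor <;> nlinarith

end IsTrigSum

/-- The point `z + ∫ m + (∫ σ²)^{1/2} ξ` (integrals over `[t₀, u]`): for a standard normal `ξ`,
this is the position at time `u` of the diffusion with drift `m` and volatility `σ` started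
from `z` at time `t₀`. -/
noncomputable def gaussPoint (m σ : ℝ → ℝ) (t₀ z u ξ : ℝ) : ℝ :=
  z + (∫ v in t₀..u, m v) + √(∫ v in t₀..u, σ v ^ 2) * ξ

/-- The product of Lebesgue measure on `(t₀, T]` and of the standard normal distribution. -/
noncomputable def timeGauss (t₀ T : ℝ) : Measure (ℝ × ℝ) :=
  (volume.restrict (Ioc t₀ T)).prod (ProbabilityTheory.gaussianReal 0 1)

section

variable {m σ : ℝ → ℝ}

theorem continuous_primitive_of_continuous {f : ℝ → ℝ} (hf : Continuous f) (t₀ : ℝ) :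
    Continuous fun u => ∫ v in t₀..u, f v :=
  intervalIntegral.continuous_primitive (fun a b => hf.intervalIntegrable a b) t₀

theorem continuous_gaussPoint (hm : Continuous m) (hσ : Continuous σ) (t₀ : ℝ) :
    Continuous fun p : ℝ × ℝ × ℝ => gaussPoint m σ t₀ p.1 p.2.1 p.2.2 := by
  have h1 := continuous_primitive_of_continuous hm t₀
  have h2 := continuous_primitive_of_continuous (hσ.pow 2) t₀
  unfold gaussPoint
  exact (continuous_fst.add (h1.comp (by fun_prop))).add
    ((continuous_sqrt.comp (h2.comp (by fun_prop))).mul (by fun_prop))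

theorem exists_expWeight_gaussPoint_le (hm : Continuous m) (hσ : Continuous σ) (t₀ T X : ℝ) :
    ∃ C S, 0 ≤ C ∧ ∀ u ∈ Icc t₀ T, ∀ z, |z| ≤ X → ∀ ξ,
      expWeight (gaussPoint m σ t₀ z u ξ) ≤ C * expWeight (S * ξ) := by
  have h1 := continuous_primitive_of_continuous hm t₀
  have h2 := continuous_sqrt.comp (continuous_primitive_of_continuous (hσ.pow 2) t₀)
  obtain ⟨B₁, hB₁⟩ := isCompact_Icc.exists_bound_of_continuousOn
    (h1.continuousOn (s := Icc t₀ T))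
  obtain ⟨B₂, hB₂⟩ := isCompact_Icc.exists_bound_of_continuousOn
    (h2.continuousOn (s := Icc t₀ T))
  refine ⟨2 * exp (2 * (X + B₁)), B₂, by positivity, fun u hu z hz ξ => ?_⟩
  refine expWeight_add_mul_le ?_ (hB₂ u hu)
  exact (abs_add_le _ _).trans (add_le_add hz (hB₁ u hu))

theorem continuous_comp_gaussPoint (hm : Continuous m) (hσ : Continuous σ) {G : ℝ → ℝ → ℝ}
    (hG : Continuous (fun p : ℝ × ℝ => G p.1 p.2)) (t₀ z : ℝ) :
    Continuous fun p : ℝ × ℝ => G p.1 (gaussPoint m σ t₀ z p.1 p.2) :=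
  hG.comp (continuous_fst.prodMk ((continuous_gaussPoint hm hσ t₀).comp
    (f := fun p : ℝ × ℝ => (z, p.1, p.2)) (by fun_prop)))

theorem ae_timeGauss_mem (t₀ T : ℝ) : ∀ᵐ p ∂timeGauss t₀ T, p.1 ∈ Ioc t₀ T := by
  have h : ∀ᵐ u ∂(volume.restrict (Ioc t₀ T)), u ∈ Ioc t₀ T := ae_restrict_mem measurableSet_Ioc
  exact Measure.quasiMeasurePreserving_fst.ae h

theorem integrable_comp_gaussPoint (hm : Continuous m) (hσ : Continuous σ) {G : ℝ → ℝ → ℝ}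
    (hG : Continuous (fun p : ℝ × ℝ => G p.1 p.2)) {t₀ T C : ℝ}
    (hgrow : ∀ u ∈ Icc t₀ T, ∀ z, |G u z| ≤ C * expWeight z) (z : ℝ) :
    Integrable (fun p : ℝ × ℝ => G p.1 (gaussPoint m σ t₀ z p.1 p.2)) (timeGauss t₀ T) := by
  obtain ⟨D, S, -, hD⟩ := exists_expWeight_gaussPoint_le hm hσ t₀ T |z|
  have hi : Integrable (fun p : ℝ × ℝ => |C| * (D * expWeight (S * p.2))) (timeGauss t₀ T) := by
    have := (integrable_expWeight_gaussianReal S).comp_snd (volume.restrict (Ioc t₀ T))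
    exact (this.const_mul D).const_mul |C|
  refine hi.mono' (continuous_comp_gaussPoint hm hσ hG t₀ z).aestronglyMeasurable ?_
  filter_upwards [ae_timeGauss_mem t₀ T] with p hp
  have hp' := Ioc_subset_Icc_self hp
  calc ‖G p.1 (gaussPoint m σ t₀ z p.1 p.2)‖
      ≤ C * expWeight (gaussPoint m σ t₀ z p.1 p.2) := hgrow _ hp' _
    _ ≤ |C| * expWeight (gaussPoint m σ t₀ z p.1 p.2) :=
        mul_le_mul_of_nonneg_right (le_abs_self C) (expWeight_pos _).le
    _ ≤ |C| * (D * expWeight (S * p.2)) :=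
        mul_le_mul_of_nonneg_left (hD _ hp' z le_rfl _) (abs_nonneg C)

end

namespace IsTrigSum

theorem continuous {g : ℝ → ℝ → ℝ} (hg : IsTrigSum g) :
    Continuous fun p : ℝ × ℝ => g p.1 p.2 := by
  induction hg with
  | basic a ha ω θ => fun_prop
  | add _ _ h1 h2 => exact h1.add h2

theorem exists_bound {g : ℝ → ℝ → ℝ} (hg : IsTrigSum g) (t₁ T : ℝ) :
    ∃ C, ∀ u ∈ Icc t₁ T, ∀ z, |g u z| ≤ C * expWeight z := by
  induction hg with
  | basic a ha ω θ =>
    obtain ⟨C, hC⟩ := isCompact_Icc.exists_bound_of_continuousOn (ha.continuousOn (s := Icc t₁ T))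
    refine ⟨C, fun u hu z => ?_⟩
    have h1 : |a u| ≤ C := hC u hu
    rw [abs_mul]
    exact mul_le_mul h1 ((abs_cos_le_one _).trans (by linarith [two_le_expWeight z]))
      (abs_nonneg _) ((abs_nonneg _).trans h1)
  | add _ _ h1 h2 =>
    obtain ⟨C, hC⟩ := h1
    obtain ⟨D, hD⟩ := h2
    refine ⟨C + D, fun u hu z => (abs_add_le _ _).trans ?_⟩
    rw [add_mul]
    exact add_le_add (hC u hu z) (hD u hu z)

theorem exists_solution {m σ : ℝ → ℝ} (hm : Continuous m) (hσ : Continuous σ) {t₀ T : ℝ}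
    (h0 : t₀ ≤ T) {g : ℝ → ℝ → ℝ} (hg : IsTrigSum g) :
    ∃ (ψ : ℝ → ℝ → ℝ) (b : ℝ → ℝ), Continuous (fun p : ℝ × ℝ => ψ p.1 p.2) ∧ Continuous b ∧
      (∀ t z, |ψ t z| ≤ b t) ∧ (∀ z, ψ T z = 0) ∧
      (∀ t z y, HasGenAt (m t) (σ t ^ 2 / 2) (fun t z _ => ψ t z) t z y (-g t z)) ∧
      ∀ z, ψ t₀ z = ∫ p, g p.1 (gaussPoint m σ t₀ z p.1 p.2) ∂timeGauss t₀ T := by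
  induction hg with
  | @add g₁ g₂ hg₁ hg₂ ih1 ih2 =>
    obtain ⟨ψ, b, h1, h2, h3, h4, h5, h6⟩ := ih1
    obtain ⟨ψ', b', h1', h2', h3', h4', h5', h6'⟩ := ih2
    obtain ⟨C, hC⟩ := hg₁.exists_bound t₀ T
    obtain ⟨C', hC'⟩ := hg₂.exists_bound t₀ T
    refine ⟨fun t z => ψ t z + ψ' t z, fun t => b t + b' t, h1.add h1', h2.add h2',
      fun t z => (abs_add_le _ _).trans (add_le_add (h3 t z) (h3' t z)), ?_, ?_, ?_⟩
    · intro z; simp [h4, h4']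
    · intro t z y
      exact ((h5 t z y).add (h5' t z y)).congr_val (by ring)
    · intro z
      beta_reduce
      rw [h6, h6', ← integral_add (integrable_comp_gaussPoint hm hσ hg₁.continuous hC z)
        (integrable_comp_gaussPoint hm hσ hg₂.continuous hC' z)]
  | basic a ha ω θ =>
    set M : ℝ → ℝ := fun u => ∫ v in t₀..u, m v with hM
    set N : ℝ → ℝ := fun u => ∫ v in t₀..u, σ v ^ 2 with hN
    have hMc : Continuous M := continuous_primitive_of_continuous hm t₀
    have hNc : Continuous N := continuous_primitive_of_continuous (hσ.pow 2) t₀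
    have hMd : ∀ t, HasDerivAt M (m t) t := fun t => (hm.integral_hasStrictDerivAt t₀ t).hasDerivAt
    have hNd : ∀ t, HasDerivAt N (σ t ^ 2) t :=
      fun t => ((hσ.pow 2).integral_hasStrictDerivAt t₀ t).hasDerivAt
    set fc : ℝ → ℝ := fun u => a u * exp (-(ω ^ 2 * N u / 2)) * cos (ω * M u) with hfc
    set fs : ℝ → ℝ := fun u => a u * exp (-(ω ^ 2 * N u / 2)) * sin (ω * M u) with hfs
    have hfcc : Continuous fc := by fun_prop
    have hfsc : Continuous fs := by fun_prop
    set Ic : ℝ → ℝ := fun t => ∫ u in T..t, fc u with hIc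
    set Is : ℝ → ℝ := fun t => ∫ u in T..t, fs u with hIs
    have hIcd : ∀ t, HasDerivAt Ic (fc t) t :=
      fun t => (hfcc.integral_hasStrictDerivAt T t).hasDerivAt
    have hIsd : ∀ t, HasDerivAt Is (fs t) t :=
      fun t => (hfsc.integral_hasStrictDerivAt T t).hasDerivAt
    have hIcc : Continuous Ic := continuous_primitive_of_continuous hfcc T
    have hIsc : Continuous Is := continuous_primitive_of_continuous hfsc T
    refine ⟨fun t z => exp (ω ^ 2 * N t / 2) *
      (sin (ω * z - ω * M t + θ) * Is t - cos (ω * z - ω * M t + θ) * Ic t),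
      fun t => exp (ω ^ 2 * N t / 2) * (|Is t| + |Ic t|), by fun_prop, by fun_prop, ?_, ?_, ?_, ?_⟩
    · intro t z
      rw [abs_mul, abs_of_pos (exp_pos _)]
      refine mul_le_mul_of_nonneg_left ((abs_sub _ _).trans ?_) (exp_pos _).le
      rw [abs_mul, abs_mul]
      exact add_le_add (mul_le_of_le_one_left (abs_nonneg _) (abs_sin_le_one _))
        (mul_le_of_le_one_left (abs_nonneg _) (abs_cos_le_one _))
    · intro z; simp [hIc, hIs]
    · intro t z y
      have hβ : HasDerivAt (fun u => ω * z - ω * M u + θ) (-(ω * m t)) t := by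
        simpa using (((hMd t).const_mul ω).const_sub (ω * z)).add_const θ
      have hE : HasDerivAt (fun u => exp (ω ^ 2 * N u / 2))
          (exp (ω ^ 2 * N t / 2) * (ω ^ 2 * σ t ^ 2 / 2)) t :=
        (((hNd t).const_mul (ω ^ 2)).div_const 2).exp
      have hβz : ∀ x, HasDerivAt (fun x => ω * x - ω * M t + θ) ω x := fun x => by
        simpa using (((hasDerivAt_id x).const_mul ω).sub_const (ω * M t)).add_const θ
      refine ⟨_, 0, _, _, hE.mul ((hβ.sin.mul (hIsd t)).sub (hβ.cos.mul (hIcd t))),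
        hasDerivAt_const _ _,
        Eventually.of_forall fun x => (((hβz x).sin.mul_const (Is t)).sub
          ((hβz x).cos.mul_const (Ic t))).const_mul _,
        ((((hβz z).cos.mul_const ω).mul_const (Is t)).sub
          (((hβz z).sin.neg.mul_const ω).mul_const (Ic t))).const_mul _, ?_⟩
      have e1 : cos (ω * z + θ) = cos (ω * z - ω * M t + θ) * cos (ω * M t)
          - sin (ω * z - ω * M t + θ) * sin (ω * M t) := by
        rw [← cos_add]; ring_nf
      have e2 : exp (ω ^ 2 * N t / 2) * exp (-(ω ^ 2 * N t / 2)) = 1 := by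
        rw [← exp_add]; simp
      beta_reduce
      rw [e1]
      simp only [hfc, hfs]
      linear_combination (a t * (sin (ω * z - ω * M t + θ) * sin (ω * M t)
        - cos (ω * z - ω * M t + θ) * cos (ω * M t))) * e2
    · intro z
      have hgc : IsTrigSum fun u z => a u * cos (ω * z + θ) := basic a ha ω θ
      obtain ⟨C, hC⟩ := hgc.exists_bound t₀ T
      have hint := integrable_comp_gaussPoint hm hσ hgc.continuous hC z
      rw [timeGauss] at hint ⊢
      rw [integral_prod _ hint, ← intervalIntegral.integral_of_le h0]
      have hM0 : M t₀ = 0 := by simp [hM]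
      have hN0 : N t₀ = 0 := by simp [hN]
      have e : ∀ u ∈ uIcc t₀ T, (∫ ξ, a u * cos (ω * gaussPoint m σ t₀ z u ξ + θ)
          ∂(ProbabilityTheory.gaussianReal 0 1))
          = cos (ω * z + θ) * fc u - sin (ω * z + θ) * fs u := by
        intro u hu
        rw [uIcc_of_le h0] at hu
        have hNn : 0 ≤ N u := intervalIntegral.integral_nonneg hu.1 fun v _ => sq_nonneg _
        have e1 : ∀ ξ, cos (ω * gaussPoint m σ t₀ z u ξ + θ)
            = cos ((ω * √(N u)) * ξ + (ω * z + θ + ω * M u)) := by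
          intro ξ; simp only [gaussPoint, hM, hN]; ring_nf
        simp_rw [e1]
        rw [integral_const_mul, integral_cos_gaussianReal, mul_pow, sq_sqrt hNn, cos_add]
        simp only [hfc, hfs]
        ring
      rw [intervalIntegral.integral_congr e, intervalIntegral.integral_sub
        ((hfcc.const_mul _).intervalIntegrable _ _) ((hfsc.const_mul _).intervalIntegrable _ _),
        intervalIntegral.integral_const_mul, intervalIntegral.integral_const_mul]
      simp only [hM0, hN0, hIc, hIs, intervalIntegral.integral_symm t₀ T]
      simp
      ring

end IsTrigSum

theorem hasDerivAt_expWeight (z : ℝ) :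
    HasDerivAt expWeight (2 * exp (2 * z) - 2 * exp (-(2 * z))) z := by
  have h1 : HasDerivAt (fun z : ℝ => 2 * z) 2 z := by simpa using (hasDerivAt_id z).const_mul 2
  have := h1.exp.add h1.neg.exp
  refine this.congr_deriv ?_
  simp only [Pi.neg_apply]; ring

theorem exists_hasGenAt_barrier {m q κ T t : ℝ} (hq : 0 ≤ q) (hκ : 2 * |m| + 4 * q + 1 ≤ κ)
    (ht : t ≤ T) (z y : ℝ) :
    ∃ ℓ, ℓ ≤ -expWeight z ∧
      HasGenAt m q (fun t z _ => exp (κ * (T - t)) * expWeight z) t z y ℓ := by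
  have hE : HasDerivAt (fun u => exp (κ * (T - u))) (exp (κ * (T - t)) * (κ * -1)) t :=
    (((hasDerivAt_id t).const_sub T).const_mul κ).exp
  have hw2 : HasDerivAt (fun z : ℝ => 2 * exp (2 * z) - 2 * exp (-(2 * z)))
      (4 * expWeight z) z := by
    have h1 : HasDerivAt (fun z : ℝ => 2 * z) 2 z := by simpa using (hasDerivAt_id z).const_mul 2
    refine ((h1.exp.const_mul 2).sub (h1.neg.exp.const_mul 2)).congr_deriv ?_
    simp only [expWeight, Pi.neg_apply]; ring
  refine ⟨_, ?_, _, _, _, _, hE.mul_const (expWeight z), hasDerivAt_const _ _,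
    Eventually.of_forall fun x => (hasDerivAt_expWeight x).const_mul _, hw2.const_mul _, rfl⟩
  have hκ0 : 0 ≤ κ := by linarith [abs_nonneg m]
  have h1 : 1 ≤ exp (κ * (T - t)) := one_le_exp (mul_nonneg hκ0 (by linarith))
  have h2 : m * (2 * exp (2 * z) - 2 * exp (-(2 * z))) ≤ 2 * |m| * expWeight z := by
    refine (le_abs_self _).trans ?_
    rw [abs_mul]
    have : |2 * exp (2 * z) - 2 * exp (-(2 * z))| ≤ 2 * expWeight z := by
      unfold expWeight
      rw [abs_le]
      constructor <;> linarith [exp_pos (2 * z), exp_pos (-(2 * z))]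
    calc |m| * |2 * exp (2 * z) - 2 * exp (-(2 * z))| ≤ |m| * (2 * expWeight z) := by gcongr
      _ = _ := by ring
  have hw := expWeight_pos z
  have h3 : -κ * expWeight z + m * (2 * exp (2 * z) - 2 * exp (-(2 * z)))
      + q * (4 * expWeight z) ≤ -expWeight z := by
    nlinarith
  calc _ = exp (κ * (T - t)) * (-κ * expWeight z + m * (2 * exp (2 * z) - 2 * exp (-(2 * z)))
      + q * (4 * expWeight z)) := by ring
    _ ≤ exp (κ * (T - t)) * (-expWeight z) := by gcongr
    _ ≤ -expWeight z := by nlinarith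

theorem exists_tube_near {H : ℝ → ℝ → ℝ → ℝ} {t₁ T a η₀ C δ : ℝ} (hη₀ : 0 < η₀) (hδ : 0 < δ)
    (hH : ContinuousOn (fun p : ℝ × ℝ × ℝ => H p.1 p.2.1 p.2.2)
      {p | p.1 ∈ Icc t₁ T ∧ |p.1 - p.2.2 - a| ≤ η₀})
    (hHg : ∀ t z y, t ∈ Icc t₁ T → |t - y - a| ≤ η₀ → |H t z y| ≤ C * exp |z|) :
    ∃ η, 0 < η ∧ η ≤ η₀ ∧ ∀ t z y, t ∈ Icc t₁ T → |t - y - a| ≤ η →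
      |H t z y - H t z (t - a)| ≤ δ * expWeight z := by
  set R : ℝ := 2 * C / δ with hR
  set S : Set (ℝ × ℝ × ℝ) := Icc t₁ T ×ˢ Icc (-R) R ×ˢ Icc (-η₀) η₀ with hS
  have hScpt : IsCompact S := isCompact_Icc.prod (isCompact_Icc.prod isCompact_Icc)
  have hc : ContinuousOn (fun p : ℝ × ℝ × ℝ => H p.1 p.2.1 (p.1 - a - p.2.2)) S := by
    refine hH.comp (f := fun p : ℝ × ℝ × ℝ => (p.1, p.2.1, p.1 - a - p.2.2)) (by fun_prop) ?_
    rintro ⟨t, z, q⟩ ⟨h1, h2, h3⟩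
    refine ⟨h1, ?_⟩
    simp only at h3 ⊢
    rw [show t - (t - a - q) - a = q by ring]
    exact abs_le.2 h3
  obtain ⟨η, hη, hη'⟩ := Metric.uniformContinuousOn_iff.1
    (hScpt.uniformContinuousOn_of_continuous hc) δ hδ
  refine ⟨min (η / 2) η₀, by positivity, min_le_right _ _, fun t z y ht hy => ?_⟩
  have hy1 : |t - y - a| ≤ η / 2 := hy.trans (min_le_left _ _)
  have hy2 : |t - y - a| ≤ η₀ := hy.trans (min_le_right _ _)
  have hw := two_le_expWeight z
  by_cases hz : |z| ≤ R
  · have h := hη' (t, z, t - y - a) ⟨ht, abs_le.1 hz, abs_le.1 hy2⟩ (t, z, 0)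
      ⟨ht, abs_le.1 hz, by simpa using hη₀.le⟩ ?_
    · simp only [Real.dist_eq, sub_zero] at h
      rw [show t - a - (t - y - a) = y by ring] at h
      nlinarith
    · simp only [Prod.dist_eq, dist_self, Real.dist_eq, sub_zero]
      rw [max_eq_right (le_max_left _ _), max_eq_right (abs_nonneg _)]
      linarith
  · push Not at hz
    have h1 := hHg t z y ht hy2
    have h2 := hHg t z (t - a) ht (by simpa using hη₀.le)
    have h3 : 2 * C ≤ δ * exp |z| := by
      have : 2 * C / δ ≤ exp |z| := by linarith [add_one_le_exp |z|]
      rw [div_le_iff₀ hδ] at this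
      linarith
    have h4 : exp (2 * |z|) = exp |z| * exp |z| := by rw [← exp_add]; ring_nf
    calc |H t z y - H t z (t - a)| ≤ |H t z y| + |H t z (t - a)| := abs_sub _ _
      _ ≤ 2 * C * exp |z| := by linarith
      _ ≤ δ * exp |z| * exp |z| := by gcongr
      _ = δ * exp (2 * |z|) := by rw [h4]; ring
      _ ≤ _ := by gcongr; exact exp_two_abs_le_expWeight z

section

variable {m σ : ℝ → ℝ} {V H : ℝ → ℝ → ℝ → ℝ} {G : ℝ → ℝ → ℝ} {t₀ t₁ T a η₀ C : ℝ}

theorem le_integral_gaussPoint (hm : Continuous m) (hσ : Continuous σ) (h01 : t₁ < t₀)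
    (h0T : t₀ < T) (hη₀ : 0 < η₀)
    (hV : ContinuousOn (fun p : ℝ × ℝ × ℝ => V p.1 p.2.1 p.2.2)
      {p | p.1 ∈ Icc t₁ T ∧ |p.1 - p.2.2 - a| ≤ η₀})
    (hVg : ∀ t z y, t ∈ Icc t₁ T → |t - y - a| ≤ η₀ → |V t z y| ≤ C * exp |z|)
    (hVT : ∀ z y, |T - y - a| ≤ η₀ → V T z y = 0)
    (hH : ContinuousOn (fun p : ℝ × ℝ × ℝ => H p.1 p.2.1 p.2.2)
      {p | p.1 ∈ Icc t₁ T ∧ |p.1 - p.2.2 - a| ≤ η₀})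
    (hHg : ∀ t z y, t ∈ Icc t₁ T → |t - y - a| ≤ η₀ → |H t z y| ≤ C * exp |z|)
    (hG : Continuous fun p : ℝ × ℝ => G p.1 p.2)
    (hGH : ∀ u ∈ Icc t₁ T, ∀ z, G u z = H u z (u - a))
    (hgen : ∀ t z y, t ∈ Ioo t₁ T → |t - y - a| < η₀ →
      HasGenAt (m t) (σ t ^ 2 / 2) V t z y (-H t z y)) (z₀ : ℝ) :
    V t₀ z₀ (t₀ - a) ≤ ∫ p, G p.1 (gaussPoint m σ t₀ z₀ p.1 p.2) ∂timeGauss t₀ T := by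
  obtain ⟨κ₁, hκ₁⟩ := isCompact_Icc.exists_bound_of_continuousOn (s := Icc t₁ T)
    (f := fun t => 2 * |m t| + 4 * (σ t ^ 2 / 2) + 1) (by fun_prop)
  have hκ : ∀ t ∈ Icc t₁ T, 2 * |m t| + 4 * (σ t ^ 2 / 2) + 1 ≤ κ₁ :=
    fun t ht => (le_abs_self _).trans (hκ₁ t ht)
  have hκ0 : 0 ≤ κ₁ := (norm_nonneg _).trans (hκ₁ T ⟨by linarith, le_rfl⟩)
  have hC : 0 ≤ C := by
    have := (abs_nonneg _).trans (hVg T 0 (T - a) ⟨by linarith, le_rfl⟩ (by simpa using hη₀.le))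
    simpa using this
  have hGg : ∀ u ∈ Icc t₁ T, ∀ z, |G u z| ≤ C * exp |z| := fun u hu z => by
    rw [hGH u hu]; exact hHg u z _ hu (by simpa using hη₀.le)
  have hGg' : ∀ u ∈ Icc t₀ T, ∀ z, |G u z| ≤ C * expWeight z := fun u hu z =>
    (hGg u ⟨h01.le.trans hu.1, hu.2⟩ z).trans <| mul_le_mul_of_nonneg_left
      ((exp_le_exp.2 (by linarith [abs_nonneg z])).trans (exp_two_abs_le_expWeight z)) hC
  have hwint := integrable_comp_gaussPoint hm hσ (G := fun _ z => expWeight z)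
    (continuous_expWeight.comp continuous_snd) (t₀ := t₀) (T := T) (C := 1)
    (fun u _ z => by rw [one_mul, abs_of_pos (expWeight_pos z)]) z₀
  set Iw : ℝ := ∫ p, expWeight (gaussPoint m σ t₀ z₀ p.1 p.2) ∂timeGauss t₀ T with hIw
  set IG : ℝ := ∫ p, G p.1 (gaussPoint m σ t₀ z₀ p.1 p.2) ∂timeGauss t₀ T with hIG
  set D : ℝ := exp (κ₁ * (T - t₀)) * expWeight z₀ + 1 + Iw / 4 with hD
  suffices key : ∀ δ, 0 < δ → V t₀ z₀ (t₀ - a) ≤ IG + δ * D by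
    have hD0 : 0 < D := by
      have : 0 ≤ Iw := integral_nonneg fun p => (expWeight_pos _).le
      have := expWeight_pos z₀
      positivity
    refine le_of_forall_pos_le_add fun ε hε => ?_
    have := key (ε / D) (by positivity)
    rwa [div_mul_cancel₀ _ hD0.ne'] at this
  intro δ hδ
  obtain ⟨g, hg, hgG⟩ := IsTrigSum.exists_near_of_growth hG hGg (show 0 < δ / 4 by positivity)
  obtain ⟨ψ, b, hψ, hb, hψb, hψT, hψgen, hψ0⟩ := hg.exists_solution hm hσ h0T.le
  obtain ⟨η, hη, hηη, hηH⟩ := exists_tube_near hη₀ (show 0 < δ / 4 by positivity) hH hHg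
  obtain ⟨β, hβ⟩ := isCompact_Icc.exists_bound_of_continuousOn (hb.continuousOn (s := Icc t₁ T))
  have hβ' : ∀ t ∈ Icc t₁ T, ∀ z, |ψ t z| ≤ β :=
    fun t ht z => (hψb t z).trans ((le_abs_self _).trans (hβ t ht))
  have hβ0 : 0 ≤ β := (norm_nonneg _).trans (hβ T ⟨by linarith, le_rfl⟩)
  set Z : ℝ := |z₀| + (C + β) / δ with hZ
  have hZ0 : |z₀| ≤ Z := by
    have : 0 ≤ (C + β) / δ := by positivity
    linarith
  set A : ℝ := C * exp Z + β with hA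
  have hA0 : 0 ≤ A := by positivity
  have hAw : A ≤ δ * exp (2 * Z) := by
    have h1 : (C + β) / δ ≤ exp Z := by linarith [add_one_le_exp Z, abs_nonneg z₀]
    rw [div_le_iff₀ hδ] at h1
    have h2 : 1 ≤ exp Z := one_le_exp ((abs_nonneg _).trans hZ0)
    have h3 : exp (2 * Z) = exp Z * exp Z := by rw [← exp_add]; ring_nf
    rw [h3, hA]
    nlinarith
  have hVψ : ∀ t z y, t ∈ Icc t₁ T → |z| ≤ Z → |t - y - a| ≤ η → V t z y - ψ t z ≤ A := by
    intro t z y ht hz hy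
    have h1 := (le_abs_self _).trans (hVg t z y ht (hy.trans hηη))
    have h2 := (neg_le_abs _).trans (hβ' t ht z)
    have h3 : C * exp |z| ≤ C * exp Z := by gcongr
    linarith
  set n : ℝ := A / δ / (t₀ - t₁) with hn
  have h10 : 0 < t₀ - t₁ := by linarith
  have hn0 : 0 ≤ n := by positivity
  set W : ℝ → ℝ → ℝ → ℝ := fun t z y => V t z y - (((ψ t z
    + δ * (exp (κ₁ * (T - t)) * expWeight z)) + A * exp (-(n * (t - t₁))))
    + A / η ^ 2 * (t - y - a) ^ 2) with hW
  have hB : ∀ t ∈ Icc t₁ T, ∀ z, expWeight z ≤ exp (κ₁ * (T - t)) * expWeight z := by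
    intro t ht z
    exact le_mul_of_one_le_left (expWeight_pos z).le
      (one_le_exp (mul_nonneg hκ0 (by linarith [ht.2])))
  have hE : ∀ t, 0 ≤ A * exp (-(n * (t - t₁))) := fun t => by positivity
  have hQ : ∀ x : ℝ, 0 ≤ A / η ^ 2 * x ^ 2 := fun x => by positivity
  have hWle : W t₀ z₀ (t₀ - a) ≤ 0 := by
    refine tube_maximum_principle (m := m) (q := fun t => σ t ^ 2 / 2) (t₁ := t₁) (T := T) (a := a)
      (η := η) (Z := Z) (fun t => by positivity) ?_ ?_ ?_ ?_ ?_ ?_ ⟨h01.le, h0T.le⟩ hZ0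
      (by simpa using hη.le)
    · refine ContinuousOn.sub (hV.mono fun p hp => ⟨hp.1, hp.2.2.trans hηη⟩) ?_
      refine Continuous.continuousOn ?_
      have h1 : Continuous fun p : ℝ × ℝ × ℝ => ψ p.1 p.2.1 :=
        hψ.comp (f := fun p : ℝ × ℝ × ℝ => (p.1, p.2.1)) (by fun_prop)
      have h2 : Continuous fun p : ℝ × ℝ × ℝ => expWeight p.2.1 :=
        continuous_expWeight.comp (by fun_prop)
      fun_prop
    · intro z y hz hy
      have hmem : t₁ ∈ Icc t₁ T := ⟨le_rfl, by linarith⟩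
      have h1 := hVψ t₁ z y hmem hz hy
      have h2 := hB t₁ hmem z
      have h3 := hQ (t₁ - y - a)
      have h4 := expWeight_pos z
      have h5 : 0 ≤ δ * (exp (κ₁ * (T - t₁)) * expWeight z) := by positivity
      simp only [hW, sub_self, mul_zero, neg_zero, exp_zero, mul_one]
      linarith
    · intro z y hz hy
      have h1 := hVT z y (hy.trans hηη)
      have h3 := hQ (T - y - a)
      have h4 := expWeight_pos z
      have h5 : 0 ≤ δ * (exp (κ₁ * (T - T)) * expWeight z) := by positivity
      simp only [hW, h1, hψT]
      linarith [hE T]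
    · intro t z y ht hz hy
      have h1 := hVψ t z y ht hz.le hy
      have h2 := hB t ht z
      have h3 := hQ (t - y - a)
      have h4 := exp_two_abs_le_expWeight z
      rw [hz] at h4
      have h5 : δ * exp (2 * Z) ≤ δ * (exp (κ₁ * (T - t)) * expWeight z) := by
        gcongr; exact h4.trans h2
      simp only [hW]
      linarith [hE t]
    · intro t z y ht hz hy
      have h1 := hVψ t z y ht hz hy.le
      have h4 := expWeight_pos z
      have h5 : 0 ≤ δ * (exp (κ₁ * (T - t)) * expWeight z) := by positivity
      have h6 : A / η ^ 2 * (t - y - a) ^ 2 = A := by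
        rw [← sq_abs (t - y - a), hy]; field_simp
      simp only [hW, h6]
      linarith [hE t]
    · intro t z y ht hz hy
      have ht' := Ioo_subset_Icc_self ht
      obtain ⟨ℓ, hℓ, hbar⟩ := exists_hasGenAt_barrier (m := m t) (q := σ t ^ 2 / 2) (T := T) (t := t)
        (by positivity) (hκ t ht') ht.2.le z y
      have hexp : HasGenAt (m t) (σ t ^ 2 / 2) (fun t _ _ => A * exp (-(n * (t - t₁)))) t z y
          (-(n * (A * exp (-(n * (t - t₁)))))) := by
        have h1 : HasDerivAt (fun u => A * exp (-(n * (u - t₁))))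
            (A * (exp (-(n * (t - t₁))) * -(n * 1))) t :=
          ((((hasDerivAt_id t).sub_const t₁).const_mul n).neg.exp).const_mul A
        exact ⟨_, _, _, fun _ => 0, h1, hasDerivAt_const _ _,
          Eventually.of_forall fun x => hasDerivAt_const _ _, hasDerivAt_const _ _, by ring⟩
      have hpen : HasGenAt (m t) (σ t ^ 2 / 2) (fun t _ y => A / η ^ 2 * (t - y - a) ^ 2) t z y
          0 := by
        have h1 : HasDerivAt (fun u => A / η ^ 2 * (u - y - a) ^ 2)
            (A / η ^ 2 * (2 * (t - y - a) * 1)) t := by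
          simpa using ((((hasDerivAt_id t).sub_const y).sub_const a).pow 2).const_mul (A / η ^ 2)
        have h2 : HasDerivAt (fun w => A / η ^ 2 * (t - w - a) ^ 2)
            (A / η ^ 2 * (2 * (t - y - a) * -1)) y := by
          simpa using ((((hasDerivAt_id y).const_sub t).sub_const a).pow 2).const_mul (A / η ^ 2)
        exact ⟨_, _, _, fun _ => 0, h1, h2,
          Eventually.of_forall fun x => hasDerivAt_const _ _, hasDerivAt_const _ _, by ring⟩
      refine ⟨_, ?_, (hgen t z y ht (hy.trans_le hηη)).sub
        ((((hψgen t z y).add (hbar.const_mul δ)).add hexp).add hpen)⟩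
      have h1 := (abs_le.1 (hηH t z y ht' hy.le)).2
      have h2 := (abs_le.1 (hgG t ht' z)).1
      rw [hGH t ht'] at h2
      have h3 : 0 ≤ n * (A * exp (-(n * (t - t₁)))) := mul_nonneg hn0 (hE t)
      have h4 : δ * ℓ ≤ δ * -expWeight z := by gcongr
      have h5 : 0 < δ * expWeight z := mul_pos hδ (expWeight_pos z)
      linarith
  have hAexp : A * exp (-(n * (t₀ - t₁))) ≤ δ := by
    have h1 : n * (t₀ - t₁) = A / δ := by rw [hn]; field_simp
    rw [h1, exp_neg]
    have h2 : A / δ ≤ exp (A / δ) := by linarith [add_one_le_exp (A / δ)]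
    rw [div_le_iff₀ hδ] at h2
    rw [← div_eq_mul_inv, div_le_iff₀ (exp_pos _)]
    linarith
  obtain ⟨Cg, hCg⟩ := hg.exists_bound t₀ T
  have hψI : ψ t₀ z₀ ≤ IG + δ / 4 * Iw := by
    rw [hψ0, hIG, hIw, ← integral_const_mul, ← integral_add
      (integrable_comp_gaussPoint hm hσ hG hGg' z₀) (hwint.const_mul _)]
    refine integral_mono_ae (integrable_comp_gaussPoint hm hσ hg.continuous hCg z₀)
      ((integrable_comp_gaussPoint hm hσ hG hGg' z₀).add (hwint.const_mul _)) ?_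
    filter_upwards [ae_timeGauss_mem t₀ T] with p hp
    have := (abs_le.1 (hgG p.1 ⟨(h01.trans hp.1).le, hp.2⟩ (gaussPoint m σ t₀ z₀ p.1 p.2))).2
    linarith
  simp only [hW, sub_sub_cancel, sub_self] at hWle
  rw [hD]
  nlinarith

theorem eq_integral_gaussPoint (hm : Continuous m) (hσ : Continuous σ) (h01 : t₁ < t₀)
    (h0T : t₀ < T) (hη₀ : 0 < η₀)
    (hV : ContinuousOn (fun p : ℝ × ℝ × ℝ => V p.1 p.2.1 p.2.2)
      {p | p.1 ∈ Icc t₁ T ∧ |p.1 - p.2.2 - a| ≤ η₀})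
    (hVg : ∀ t z y, t ∈ Icc t₁ T → |t - y - a| ≤ η₀ → |V t z y| ≤ C * exp |z|)
    (hVT : ∀ z y, |T - y - a| ≤ η₀ → V T z y = 0)
    (hH : ContinuousOn (fun p : ℝ × ℝ × ℝ => H p.1 p.2.1 p.2.2)
      {p | p.1 ∈ Icc t₁ T ∧ |p.1 - p.2.2 - a| ≤ η₀})
    (hHg : ∀ t z y, t ∈ Icc t₁ T → |t - y - a| ≤ η₀ → |H t z y| ≤ C * exp |z|)
    (hG : Continuous fun p : ℝ × ℝ => G p.1 p.2)
    (hGH : ∀ u ∈ Icc t₁ T, ∀ z, G u z = H u z (u - a))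
    (hgen : ∀ t z y, t ∈ Ioo t₁ T → |t - y - a| < η₀ →
      HasGenAt (m t) (σ t ^ 2 / 2) V t z y (-H t z y)) (z₀ : ℝ) :
    V t₀ z₀ (t₀ - a) = ∫ p, G p.1 (gaussPoint m σ t₀ z₀ p.1 p.2) ∂timeGauss t₀ T := by
  refine le_antisymm
    (le_integral_gaussPoint hm hσ h01 h0T hη₀ hV hVg hVT hH hHg hG hGH hgen z₀) ?_
  have h := le_integral_gaussPoint (V := fun t z y => -V t z y) (H := fun t z y => -H t z y)
    (G := fun u z => -G u z) hm hσ h01 h0T hη₀ hV.neg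
    (fun t z y ht hy => by rw [abs_neg]; exact hVg t z y ht hy)
    (fun z y hy => by rw [hVT z y hy, neg_zero]) hH.neg
    (fun t z y ht hy => by rw [abs_neg]; exact hHg t z y ht hy) hG.neg
    (fun u hu z => by rw [hGH u hu]) (fun t z y ht hy => (hgen t z y ht hy).neg) z₀
  rw [integral_neg] at h
  linarith

end

theorem gaussianPDFReal_zero_one (ξ : ℝ) :
    ProbabilityTheory.gaussianPDFReal 0 1 ξ = (√(2 * π))⁻¹ * exp (-ξ ^ 2 / 2) := by
  simp [ProbabilityTheory.gaussianPDFReal_def]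

theorem integral_gaussianReal_add_right (f : ℝ → ℝ) (b : ℝ) :
    ∫ ξ, f (ξ + b) ∂(ProbabilityTheory.gaussianReal 0 1)
      = ∫ ξ, f ξ * exp (ξ * b - b ^ 2 / 2) ∂(ProbabilityTheory.gaussianReal 0 1) := by
  rw [ProbabilityTheory.integral_gaussianReal_eq_integral_smul one_ne_zero,
    ProbabilityTheory.integral_gaussianReal_eq_integral_smul one_ne_zero]
  refine Eq.trans ?_ (integral_add_right_eq_self
    (fun ξ => ProbabilityTheory.gaussianPDFReal 0 1 ξ • (f ξ * exp (ξ * b - b ^ 2 / 2))) b)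
  refine integral_congr_ae (Eventually.of_forall fun ξ => ?_)
  simp only [gaussianPDFReal_zero_one, smul_eq_mul]
  have : exp (-ξ ^ 2 / 2) = exp (-(ξ + b) ^ 2 / 2) * exp ((ξ + b) * b - b ^ 2 / 2) := by
    rw [← exp_add]; ring_nf
  rw [this]
  ring

theorem hasDerivAt_integral_gaussianReal_shift {f : ℝ → ℝ} (hf : Continuous f) {C s : ℝ}
    (hfg : ∀ x, |f x| ≤ C * expWeight x) (hs : 0 < s) (z : ℝ) :
    HasDerivAt (fun z => ∫ ξ, f (z + s * ξ) ∂(ProbabilityTheory.gaussianReal 0 1))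
      (∫ ξ, f (z + s * ξ) * (ξ / s) ∂(ProbabilityTheory.gaussianReal 0 1)) z := by
  set γ := ProbabilityTheory.gaussianReal 0 1 with hγ
  have hC : 0 ≤ C := by
    by_contra! h
    have := (abs_nonneg _).trans (hfg 0)
    nlinarith [expWeight_pos 0]
  have hbound : ∀ ξ, |f (z + s * ξ)| ≤ C * (2 * exp (2 * |z|) * expWeight (s * ξ)) := fun ξ =>
    (hfg _).trans (mul_le_mul_of_nonneg_left
      (expWeight_add_mul_le le_rfl (abs_of_pos hs).le) hC)
  have key : HasDerivAt (fun b => ∫ ξ, f (z + s * ξ) * exp (ξ * b - b ^ 2 / 2) ∂γ)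
      (∫ ξ, f (z + s * ξ) * (exp (ξ * 0 - 0 ^ 2 / 2) * (ξ - 0)) ∂γ) 0 := by
    have hexp : ∀ ξ b : ℝ, b ∈ Metric.ball (0 : ℝ) 1 → exp (ξ * b - b ^ 2 / 2) ≤ expWeight ξ := by
      intro ξ b hb
      rw [mem_ball_zero_iff, Real.norm_eq_abs] at hb
      refine le_trans (exp_le_exp.2 ?_) (exp_two_abs_le_expWeight ξ)
      have h1 : ξ * b ≤ |ξ| * 1 := by
        refine (le_abs_self _).trans ?_
        rw [abs_mul]
        gcongr
      nlinarith [abs_nonneg ξ, sq_nonneg b]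
    refine (hasDerivAt_integral_of_dominated_loc_of_deriv_le (μ := γ)
      (F := fun b ξ => f (z + s * ξ) * exp (ξ * b - b ^ 2 / 2))
      (F' := fun b ξ => f (z + s * ξ) * (exp (ξ * b - b ^ 2 / 2) * (ξ - b)))
      (bound := fun ξ => C * (2 * exp (2 * |z|)) * (|ξ| * expWeight ((s + 1) * ξ)
        + |ξ| * expWeight ((s - 1) * ξ) + expWeight ((s + 1) * ξ) + expWeight ((s - 1) * ξ)))
      (Metric.ball_mem_nhds 0 one_pos) ?_ ?_ ?_ ?_ ?_ ?_).2
    · exact Eventually.of_forall fun b => (by fun_prop : Continuous fun ξ =>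
        f (z + s * ξ) * exp (ξ * b - b ^ 2 / 2)).aestronglyMeasurable
    · refine Integrable.mono' (((integrable_expWeight_gaussianReal s).const_mul
        (2 * exp (2 * |z|))).const_mul C) (by fun_prop : Continuous fun ξ =>
        f (z + s * ξ) * exp (ξ * 0 - 0 ^ 2 / 2)).aestronglyMeasurable
        (Eventually.of_forall fun ξ => ?_)
      simpa using hbound ξ
    · exact (by fun_prop : Continuous fun ξ =>
        f (z + s * ξ) * (exp (ξ * 0 - 0 ^ 2 / 2) * (ξ - 0))).aestronglyMeasurable
    · refine Eventually.of_forall fun ξ b hb => ?_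
      have h1 := hexp ξ b hb
      rw [mem_ball_zero_iff, Real.norm_eq_abs] at hb
      have h2 : expWeight (s * ξ) * expWeight ξ
          = expWeight ((s + 1) * ξ) + expWeight ((s - 1) * ξ) := by
        unfold expWeight
        rw [add_mul, mul_add, mul_add, ← exp_add, ← exp_add, ← exp_add, ← exp_add]
        ring_nf
      have h3 : |ξ - b| ≤ |ξ| + 1 := (abs_sub _ _).trans (by linarith)
      rw [Real.norm_eq_abs, abs_mul, abs_mul, abs_of_pos (exp_pos _)]
      calc _ ≤ C * (2 * exp (2 * |z|) * expWeight (s * ξ)) * (expWeight ξ * (|ξ| + 1)) := by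
            refine mul_le_mul (hbound ξ) ?_ (by positivity) ((abs_nonneg _).trans (hbound ξ))
            exact mul_le_mul h1 h3 (abs_nonneg _) (expWeight_pos _).le
        _ = C * (2 * exp (2 * |z|)) * ((expWeight (s * ξ) * expWeight ξ) * (|ξ| + 1)) := by ring
        _ = _ := by rw [h2]; ring
    · exact ((((integrable_abs_mul_expWeight_gaussianReal (s + 1)).add
        (integrable_abs_mul_expWeight_gaussianReal (s - 1))).add
        (integrable_expWeight_gaussianReal (s + 1))).add
        (integrable_expWeight_gaussianReal (s - 1))).const_mul _
    · refine Eventually.of_forall fun ξ b _ => HasDerivAt.const_mul _ ?_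
      have h1 : HasDerivAt (fun b : ℝ => ξ * b - b ^ 2 / 2) (ξ - b) b := by
        refine (((hasDerivAt_id b).const_mul ξ).sub (((hasDerivAt_id b).pow 2).div_const 2)).congr_deriv ?_
        simp
      exact h1.exp
  have hlin : HasDerivAt (fun x : ℝ => (x - z) / s) (1 / s) z :=
    ((hasDerivAt_id z).sub_const z).div_const s
  have hcomp := HasDerivAt.comp_of_eq z key hlin (by simp)
  have e : (fun z => ∫ ξ, f (z + s * ξ) ∂γ)
      = (fun b => ∫ ξ, f (z + s * ξ) * exp (ξ * b - b ^ 2 / 2) ∂γ) ∘ fun x : ℝ => (x - z) / s := by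
    funext x
    rw [Function.comp_apply, ← integral_gaussianReal_add_right (fun ξ => f (z + s * ξ))]
    refine integral_congr_ae (Eventually.of_forall fun ξ => ?_)
    simp only
    congr 1
    field_simp
    ring
  rw [e]
  refine hcomp.congr_deriv ?_
  rw [← integral_mul_const]
  refine integral_congr_ae (Eventually.of_forall fun ξ => ?_)
  simp only
  rw [mul_zero, zero_pow two_ne_zero, zero_div, sub_zero, exp_zero, sub_zero]
  ring

theorem integrableOn_sub_rpow_neg_half (t₀ T : ℝ) :
    IntegrableOn (fun u : ℝ => (√(u - t₀))⁻¹) (Ioc t₀ T) := by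
  rcases le_total T t₀ with h | h
  · rw [Ioc_eq_empty (not_lt.2 h)]; exact integrableOn_empty
  · have h1 : IntervalIntegrable (fun x : ℝ => x ^ (-(1 / 2) : ℝ)) volume 0 (T - t₀) :=
      intervalIntegral.intervalIntegrable_rpow' (by norm_num)
    have h2 := h1.comp_sub_right t₀
    simp only [zero_add, sub_add_cancel] at h2
    rw [intervalIntegrable_iff_integrableOn_Ioc_of_le h] at h2
    refine h2.congr_fun (fun u hu => ?_) measurableSet_Ioc
    simp only
    rw [rpow_neg (by linarith [hu.1]), sqrt_eq_rpow]

theorem hasDerivAt_integral_gaussPoint {m σ : ℝ → ℝ} {G : ℝ → ℝ → ℝ} {t₀ T C c : ℝ}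
    (hm : Continuous m) (hσ : Continuous σ) (h0T : t₀ ≤ T) (hc : 0 < c)
    (hσc : ∀ u ∈ Icc t₀ T, c ≤ σ u) (hG : Continuous fun p : ℝ × ℝ => G p.1 p.2)
    (hGg : ∀ u ∈ Icc t₀ T, ∀ z, |G u z| ≤ C * expWeight z) (z₀ : ℝ) :
    HasDerivAt (fun z => ∫ p, G p.1 (gaussPoint m σ t₀ z p.1 p.2) ∂timeGauss t₀ T)
      (∫ u in t₀..T, ∫ ξ, G u (gaussPoint m σ t₀ z₀ u ξ) * (ξ / √(∫ v in t₀..u, σ v ^ 2))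
        ∂(ProbabilityTheory.gaussianReal 0 1)) z₀ := by
  set γ := ProbabilityTheory.gaussianReal 0 1 with hγ
  have hC : 0 ≤ C := by
    by_contra! h
    have := (abs_nonneg _).trans (hGg t₀ ⟨le_rfl, h0T⟩ 0)
    nlinarith [expWeight_pos 0]
  have hN : ∀ u ∈ Icc t₀ T, c * √(u - t₀) ≤ √(∫ v in t₀..u, σ v ^ 2) := by
    intro u hu
    refine le_sqrt_of_sq_le ?_
    rw [mul_pow, sq_sqrt (by linarith [hu.1])]
    have := intervalIntegral.integral_mono_on (μ := volume) (f := fun _ => c ^ 2)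
      (g := fun v => σ v ^ 2) hu.1 (by simp)
      ((hσ.pow 2).intervalIntegrable _ _) (fun v hv =>
        pow_le_pow_left₀ hc.le (hσc v ⟨hv.1, hv.2.trans hu.2⟩) 2)
    simp only [intervalIntegral.integral_const, smul_eq_mul] at this
    linarith
  have hNc := continuous_sqrt.comp (continuous_primitive_of_continuous (hσ.pow 2) t₀)
  simp only [Function.comp_def] at hNc
  obtain ⟨D, S, hD0, hD⟩ := exists_expWeight_gaussPoint_le hm hσ t₀ T (|z₀| + 1)
  set Iw : ℝ := ∫ ξ, |ξ| * expWeight (S * ξ) ∂γ with hIw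
  have hgp : ∀ z, Continuous fun p : ℝ × ℝ => G p.1 (gaussPoint m σ t₀ z p.1 p.2) :=
    fun z => continuous_comp_gaussPoint hm hσ hG t₀ z
  have hmain := (hasDerivAt_integral_of_dominated_loc_of_deriv_le
    (μ := volume.restrict (Ioc t₀ T))
    (F := fun z u => ∫ ξ, G u (gaussPoint m σ t₀ z u ξ) ∂γ)
    (F' := fun z u => ∫ ξ, G u (gaussPoint m σ t₀ z u ξ) * (ξ / √(∫ v in t₀..u, σ v ^ 2)) ∂γ)
    (x₀ := z₀) (bound := fun u => C * D * Iw * c⁻¹ * (√(u - t₀))⁻¹)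
    (Metric.ball_mem_nhds z₀ one_pos) ?_ ?_ ?_ ?_ ?_ ?_).2
  · have e : ∀ z, ∫ p, G p.1 (gaussPoint m σ t₀ z p.1 p.2) ∂timeGauss t₀ T
        = ∫ u in Ioc t₀ T, ∫ ξ, G u (gaussPoint m σ t₀ z u ξ) ∂γ := by
      intro z
      have := integrable_comp_gaussPoint hm hσ hG hGg z
      rw [timeGauss] at this ⊢
      exact integral_prod _ this
    simp_rw [e]
    rw [intervalIntegral.integral_of_le h0T]
    exact hmain
  · exact Eventually.of_forall fun z =>
      ((hgp z).stronglyMeasurable.integral_prod_right' (ν := γ)).aestronglyMeasurable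
  · have := integrable_comp_gaussPoint hm hσ hG hGg z₀
    rw [timeGauss] at this
    exact this.integral_prod_left
  · refine (StronglyMeasurable.integral_prod_right' (ν := γ) (f := fun p : ℝ × ℝ =>
      G p.1 (gaussPoint m σ t₀ z₀ p.1 p.2) * (p.2 / √(∫ v in t₀..p.1, σ v ^ 2)))
      ?_).aestronglyMeasurable
    refine Measurable.stronglyMeasurable ((hgp z₀).measurable.mul (measurable_snd.div ?_))
    exact (hNc.comp continuous_fst).measurable
  · filter_upwards [ae_restrict_mem measurableSet_Ioc] with u hu z hz
    have hu' := Ioc_subset_Icc_self hu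
    have hz' : |z| ≤ |z₀| + 1 := by
      rw [Metric.mem_ball, Real.dist_eq] at hz
      have := abs_add_le (z - z₀) z₀
      rw [sub_add_cancel] at this
      linarith
    have hpos : 0 < √(u - t₀) := sqrt_pos.2 (by linarith [hu.1])
    have hle : (√(∫ v in t₀..u, σ v ^ 2))⁻¹ ≤ c⁻¹ * (√(u - t₀))⁻¹ := by
      rw [← mul_inv]
      exact inv_anti₀ (by positivity) (hN u hu')
    have hbd : ∀ ξ, ‖G u (gaussPoint m σ t₀ z u ξ) * (ξ / √(∫ v in t₀..u, σ v ^ 2))‖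
        ≤ C * D * (c⁻¹ * (√(u - t₀))⁻¹) * (|ξ| * expWeight (S * ξ)) := by
      intro ξ
      rw [norm_mul, Real.norm_eq_abs, Real.norm_eq_abs, abs_div, abs_of_nonneg (sqrt_nonneg _),
        div_eq_mul_inv]
      calc _ ≤ C * (D * expWeight (S * ξ)) * (|ξ| * (c⁻¹ * (√(u - t₀))⁻¹)) := by
            refine mul_le_mul ((hGg u hu' _).trans (mul_le_mul_of_nonneg_left
              (hD u hu' z hz' ξ) hC)) (mul_le_mul_of_nonneg_left hle (abs_nonneg _))
              (by positivity) ?_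
            have := (expWeight_pos (S * ξ)).le
            positivity
        _ = _ := by ring
    refine (norm_integral_le_of_norm_le
      ((integrable_abs_mul_expWeight_gaussianReal S).const_mul _)
      (Eventually.of_forall hbd)).trans (le_of_eq ?_)
    rw [integral_const_mul]
    ring
  · exact (integrableOn_sub_rpow_neg_half t₀ T).const_mul _
  · filter_upwards [ae_restrict_mem measurableSet_Ioc] with u hu z _
    have hu' := Ioc_subset_Icc_self hu
    have hpos : 0 < √(∫ v in t₀..u, σ v ^ 2) :=
      lt_of_lt_of_le (mul_pos hc (sqrt_pos.2 (by linarith [hu.1]))) (hN u hu')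
    have h := hasDerivAt_integral_gaussianReal_shift (f := G u)
      (hG.comp (f := fun x => (u, x)) (by fun_prop)) (hGg u hu') hpos (z + ∫ v in t₀..u, m v)
    have h2 : HasDerivAt (fun z : ℝ => z + ∫ v in t₀..u, m v) 1 z :=
      (hasDerivAt_id z).add_const _
    have h3 := HasDerivAt.comp z h h2
    rw [mul_one] at h3
    exact h3

theorem integral_lognormal_eq {g k : ℝ → ℝ} {s b M : ℝ} (hs : 0 < s) (hb : 0 < b) :
    ∫ x in Ioi (0 : ℝ), g x * (exp (-((log (x / s) - M) / b) ^ 2 / 2) / (√(2 * π) * x * b))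
        * k ((log (x / s) - M) / b)
      = ∫ ξ, g (exp (log s + M + b * ξ)) * k ξ ∂(ProbabilityTheory.gaussianReal 0 1) := by
  have himg : (fun ξ => exp (log s + M + b * ξ)) '' univ = Ioi 0 := by
    ext x
    simp only [image_univ, mem_range, mem_Ioi]
    constructor
    · rintro ⟨ξ, rfl⟩; exact exp_pos _
    · intro hx
      refine ⟨(log x - log s - M) / b, ?_⟩
      rw [mul_div_cancel₀ _ hb.ne']
      ring_nf
      exact exp_log hx
  have hd : ∀ ξ ∈ (univ : Set ℝ), HasDerivWithinAt (fun ξ => exp (log s + M + b * ξ))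
      (exp (log s + M + b * ξ) * b) univ ξ := by
    intro ξ _
    have h1 : HasDerivAt (fun ξ => log s + M + b * ξ) b ξ := by
      simpa using ((hasDerivAt_id ξ).const_mul b).const_add (log s + M)
    exact h1.exp.hasDerivWithinAt
  have hinj : InjOn (fun ξ => exp (log s + M + b * ξ)) univ := by
    intro x _ y _ hxy
    have := exp_injective hxy
    exact mul_left_cancel₀ hb.ne' (add_left_cancel this)
  rw [← himg, integral_image_eq_integral_abs_deriv_smul MeasurableSet.univ hd hinj,
    ProbabilityTheory.integral_gaussianReal_eq_integral_smul one_ne_zero, Measure.restrict_univ]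
  refine integral_congr_ae (Eventually.of_forall fun ξ => ?_)
  have hL : (log (exp (log s + M + b * ξ) / s) - M) / b = ξ := by
    rw [log_div (exp_pos _).ne' hs.ne', log_exp]
    field_simp
    ring
  simp only [hL, gaussianPDFReal_zero_one, smul_eq_mul]
  rw [abs_of_pos (by positivity)]
  have : √(2 * π) ≠ 0 := by positivity
  field_simp

section jumpRates

variable {k : ℕ} {lam : Fin k → Fin k → ℝ → ℝ} {i : Fin k} {c : ℝ}

theorem sumLam_nonneg (hnn : ∀ j, i ≠ j → ∀ y, 0 < y → 0 ≤ lam i j y) {y : ℝ} (hy : 0 < y) :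
    0 ≤ sumLam lam i y :=
  Finset.sum_nonneg fun j hj => hnn j (Finset.mem_filter.1 hj).2.symm y hy

theorem intervalIntegrable_sumLam (hmeas : ∀ j, i ≠ j → Measurable (lam i j))
    (hnn : ∀ j, i ≠ j → ∀ y, 0 < y → 0 ≤ lam i j y)
    (hbound : ∀ y, 0 < y → sumLam lam i y ≤ c) {y : ℝ} (hy : 0 ≤ y) :
    IntervalIntegrable (sumLam lam i) volume 0 y := by
  have hm : Measurable (sumLam lam i) :=
    Finset.measurable_fun_sum _ fun j hj => hmeas j (Finset.mem_filter.1 hj).2.symm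
  refine (intervalIntegrable_const (c := c)).mono_fun' hm.aestronglyMeasurable ?_
  filter_upwards [ae_restrict_mem measurableSet_uIoc] with v hv
  rw [uIoc_of_le hy] at hv
  rw [Real.norm_eq_abs, abs_of_nonneg (sumLam_nonneg hnn hv.1)]
  exact hbound v hv.1

theorem Lambda_nonneg (hnn : ∀ j, i ≠ j → ∀ y, 0 < y → 0 ≤ lam i j y) {y : ℝ} (hy : 0 ≤ y) :
    0 ≤ Lambda lam i y := by
  rw [Lambda, intervalIntegral.integral_of_le hy]
  exact setIntegral_nonneg measurableSet_Ioc fun v hv => sumLam_nonneg hnn hv.1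

theorem hasDerivAt_Lambda (hmeas : ∀ j, i ≠ j → Measurable (lam i j))
    (hnn : ∀ j, i ≠ j → ∀ y, 0 < y → 0 ≤ lam i j y)
    (hbound : ∀ y, 0 < y → sumLam lam i y ≤ c)
    (hdiff : ∀ j, i ≠ j → ∀ y, 0 < y → DifferentiableAt ℝ (lam i j) y) {y : ℝ} (hy : 0 < y) :
    HasDerivAt (Lambda lam i) (sumLam lam i y) y := by
  have hm : Measurable (sumLam lam i) :=
    Finset.measurable_fun_sum _ fun j hj => hmeas j (Finset.mem_filter.1 hj).2.symm
  have hcont : ContinuousAt (sumLam lam i) y :=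
    tendsto_finsetSum _ fun j hj =>
      (hdiff j (Finset.mem_filter.1 hj).2.symm y hy).continuousAt.tendsto
  exact intervalIntegral.integral_hasDerivAt_right
    (intervalIntegrable_sumLam hmeas hnn hbound hy.le)
    hm.stronglyMeasurable.stronglyMeasurableAtFilter hcont

theorem fdens_mul_pMat (hnn : ∀ j, i ≠ j → ∀ y, 0 < y → 0 ≤ lam i j y) {j : Fin k} (hj : j ≠ i)
    {y : ℝ} (hy : 0 < y) :
    fdens lam i y * pMat lam i j y = lam i j y * exp (-Lambda lam i y) := by
  rw [fdens, pMat, if_neg hj]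
  split_ifs with h
  · rw [sumLam, Finset.sum_eq_zero_iff_of_nonneg
      fun l hl => hnn l (Finset.mem_filter.1 hl).2.symm y hy] at h
    rw [h j (by simp [hj])]
    simp
  · field_simp

theorem one_sub_Fcdf (y : ℝ) : 1 - Fcdf lam i y = exp (-Lambda lam i y) := by
  rw [Fcdf]; ring

end jumpRates

/-- The chain rule from the price variable `s = exp z` to the logarithmic variable `z`, for a
function multiplied by a factor depending only on the two time variables. -/
theorem HasGenAt.of_mul_comp_exp {A : ℝ → ℝ → ℝ} {P : ℝ → ℝ → ℝ → ℝ} {t z y m q At Ay : ℝ}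
    (hAt : HasDerivAt (fun u => A u y) At t) (hAy : HasDerivAt (fun w => A t w) Ay y)
    (hPt : DifferentiableAt ℝ (fun u => P u (exp z) y) t)
    (hPy : DifferentiableAt ℝ (fun w => P t (exp z) w) y)
    (hPs : ∀ s, 0 < s → DifferentiableAt ℝ (fun x => P t x y) s)
    (hPss : DifferentiableAt ℝ (deriv (fun x => P t x y)) (exp z)) :
    HasGenAt m q (fun t z y => A t y * P t (exp z) y) t z y
      ((At + Ay) * P t (exp z) y
        + A t y * (deriv (fun u => P u (exp z) y) t + deriv (fun w => P t (exp z) w) y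
          + (m + q) * exp z * deriv (fun x => P t x y) (exp z)
          + q * exp z ^ 2 * deriv (deriv (fun x => P t x y)) (exp z))) := by
  refine ⟨_, _, _, fun x => A t y * (deriv (fun x => P t x y) (exp x) * exp x),
    hAt.mul hPt.hasDerivAt, hAy.mul hPy.hasDerivAt, Eventually.of_forall fun x => ?_,
    ((hPss.hasDerivAt.comp z (hasDerivAt_exp z)).mul (hasDerivAt_exp z)).const_mul _, ?_⟩
  · exact ((hPs _ (exp_pos x)).hasDerivAt.comp x (hasDerivAt_exp x)).const_mul _
  · simp only [Function.comp_apply]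
    ring

theorem integrable_comp_add_mul_mul_gaussianReal {g : ℝ → ℝ} (hg : Continuous g) {C : ℝ}
    (hgC : ∀ z, |g z| ≤ C * expWeight z) (x S : ℝ) :
    Integrable (fun ξ => g (x + S * ξ) * ξ) (ProbabilityTheory.gaussianReal 0 1) := by
  have hC : 0 ≤ C := by
    by_contra! h
    have := (abs_nonneg _).trans (hgC 0)
    nlinarith [expWeight_pos 0]
  refine ((integrable_abs_mul_expWeight_gaussianReal |S|).const_mul
    (C * (2 * exp (2 * |x|)))).mono' (by fun_prop) (Eventually.of_forall fun ξ => ?_)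
  rw [Real.norm_eq_abs, abs_mul]
  have := expWeight_add_mul_le (ξ := ξ) le_rfl (le_refl |S|) (x := x)
  calc |g (x + S * ξ)| * |ξ| ≤ (C * expWeight (x + S * ξ)) * |ξ| := by gcongr; exact hgC _
    _ ≤ (C * (2 * exp (2 * |x|) * expWeight (|S| * ξ))) * |ξ| := by gcongr
    _ = _ := by ring

section representation

variable {k : ℕ} {lam : Fin k → Fin k → ℝ → ℝ} {i : Fin k} {c T M : ℝ} {r : Fin k → ℝ}
  {σ : ℝ → Fin k → ℝ} {ρ : Fin k → ℝ → ℝ → ℝ} {φ : ℝ → ℝ → Fin k → ℝ → ℝ}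

/-- The difference of `φ` and the survival-weighted solution `ρ`, in the logarithmic price `z`,
discounted and weighted by the survival probability `exp (-Λ)`. -/
noncomputable def discountedGap (lam : Fin k → Fin k → ℝ → ℝ) (r : Fin k → ℝ) (T : ℝ)
    (ρ : Fin k → ℝ → ℝ → ℝ) (φ : ℝ → ℝ → Fin k → ℝ → ℝ) (i : Fin k) (t z y : ℝ) : ℝ :=
  exp (-(r i * t)) * exp (-Lambda lam i y) * φ t (exp z) i y
    - exp (-(r i * t)) * exp (-Lambda lam i (T - t + y)) * ρ i t (exp z)

/-- The jump source term driving `discountedGap`. -/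
noncomputable def jumpSource (lam : Fin k → Fin k → ℝ → ℝ) (r : Fin k → ℝ)
    (φ : ℝ → ℝ → Fin k → ℝ → ℝ) (i : Fin k) (t z y : ℝ) : ℝ :=
  exp (-(r i * t)) * exp (-Lambda lam i y)
    * ∑ j ∈ Finset.univ.filter (fun j => j ≠ i), lam i j y * φ t (exp z) j 0

theorem hasGenAt_discountedGap
    (hΛ : ∀ y, 0 < y → HasDerivAt (Lambda lam i) (sumLam lam i y) y)
    (hρ : ∀ t ∈ Ioo (0 : ℝ) T, ∀ s ∈ Ioi (0 : ℝ),
      (DifferentiableAt ℝ (fun u => ρ i u s) t ∧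
       DifferentiableAt ℝ (fun x => ρ i t x) s ∧
       DifferentiableAt ℝ (deriv (fun x => ρ i t x)) s) ∧
      deriv (fun u => ρ i u s) t + r i * s * deriv (fun x => ρ i t x) s
        + (1/2) * (σ t i)^2 * s^2 * deriv (deriv (fun x => ρ i t x)) s
        = r i * ρ i t s)
    (hφdiff : ∀ t s y : ℝ, memD T t s y →
      DifferentiableAt ℝ (fun u => φ u s i y) t ∧
      DifferentiableAt ℝ (fun x => φ t x i y) s ∧
      DifferentiableAt ℝ (deriv (fun x => φ t x i y)) s ∧
      DifferentiableAt ℝ (fun w => φ t s i w) y)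
    (hφPDE : ∀ t s y : ℝ, memD T t s y →
      deriv (fun u => φ u s i y) t + deriv (fun w => φ t s i w) y
        + r i * s * deriv (fun x => φ t x i y) s
        + (1/2) * (σ t i)^2 * s^2 * deriv (deriv (fun x => φ t x i y)) s
        + ∑ j ∈ Finset.univ.filter (fun j => j ≠ i),
            lam i j y * (φ t s j 0 - φ t s i y)
        = r i * φ t s i y)
    {t y : ℝ} (ht : t ∈ Ioo 0 T) (hy : y ∈ Ioo 0 t) (z : ℝ) :
    HasGenAt (r i - σ t i ^ 2 / 2) (σ t i ^ 2 / 2) (discountedGap lam r T ρ φ i) t z y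
      (-jumpSource lam r φ i t z y) := by
  have hD : ∀ s, 0 < s → memD T t s y := fun s hs => ⟨ht, hs, hy⟩
  obtain ⟨d1, -, d3, d4⟩ := hφdiff t _ y (hD _ (exp_pos z))
  obtain ⟨⟨e1, -, e3⟩, hE⟩ := hρ t ht _ (exp_pos z)
  have hlt : HasDerivAt (fun u => exp (-(r i * u))) (exp (-(r i * t)) * (-(r i * 1))) t :=
    ((hasDerivAt_id' t).const_mul (r i)).neg.exp
  have hy' : 0 < T - t + y := by linarith [ht.2, hy.1]
  have hΛt : HasDerivAt (fun u => Lambda lam i (T - u + y)) (sumLam lam i (T - t + y) * (-1)) t :=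
    HasDerivAt.comp (h₂ := Lambda lam i) (h := fun u => T - u + y) t (hΛ _ hy')
      (((hasDerivAt_id' t).const_sub T).add_const y)
  have hΛy : HasDerivAt (fun w => Lambda lam i (T - t + w)) (sumLam lam i (T - t + y) * 1) y :=
    HasDerivAt.comp (h₂ := Lambda lam i) (h := fun w => T - t + w) y (hΛ _ hy')
      ((hasDerivAt_id' y).const_add (T - t))
  have g1 := HasGenAt.of_mul_comp_exp (m := r i - σ t i ^ 2 / 2) (q := σ t i ^ 2 / 2)
    (A := fun t y => exp (-(r i * t)) * exp (-Lambda lam i y)) (P := fun t s y => φ t s i y)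
    (hlt.mul_const (exp (-Lambda lam i y))) ((hΛ y hy.1).neg.exp.const_mul (exp (-(r i * t))))
    d1 d4 (fun s hs => (hφdiff t s y (hD s hs)).2.1) d3
  have g2 := HasGenAt.of_mul_comp_exp (m := r i - σ t i ^ 2 / 2) (q := σ t i ^ 2 / 2)
    (A := fun t y => exp (-(r i * t)) * exp (-Lambda lam i (T - t + y)))
    (P := fun t s _ => ρ i t s) (hlt.mul hΛt.neg.exp) (hΛy.neg.exp.const_mul (exp (-(r i * t))))
    e1 (differentiableAt_const _) (fun s hs => (hρ t ht s hs).1.2.1) e3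
  refine (g1.sub g2).congr_val ?_
  have hP := hφPDE t _ y (hD _ (exp_pos z))
  have hsum : ∑ j ∈ Finset.univ.filter (fun j => j ≠ i),
      lam i j y * (φ t (exp z) j 0 - φ t (exp z) i y)
      = ∑ j ∈ Finset.univ.filter (fun j => j ≠ i), lam i j y * φ t (exp z) j 0
        - sumLam lam i y * φ t (exp z) i y := by
    rw [sumLam, Finset.sum_mul, ← Finset.sum_sub_distrib]
    exact Finset.sum_congr rfl fun j _ => by ring
  rw [hsum] at hP
  rw [jumpSource]
  simp only [deriv_const]
  linear_combination exp (-(r i * t)) * exp (-Lambda lam i y) * hP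
    - exp (-(r i * t)) * exp (-Lambda lam i (T - t + y)) * hE

theorem continuousOn_discountedGap {S : Set (ℝ × ℝ × ℝ)} (hS : ∀ p ∈ S, p.1 ∈ Icc 0 T ∧
      0 < p.2.2 ∧ p.2.2 ≤ p.1)
    (hΛ : ContinuousOn (Lambda lam i) (Ioi 0))
    (hρ : ContinuousOn (fun p : ℝ × ℝ => ρ i p.1 p.2) (Icc 0 T ×ˢ Ici 0))
    (hφ : ContinuousOn (fun p : ℝ × ℝ × ℝ => φ p.1 p.2.1 i p.2.2)
      {p : ℝ × ℝ × ℝ | memDbar T p.1 p.2.1 p.2.2}) :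
    ContinuousOn (fun p : ℝ × ℝ × ℝ => discountedGap lam r T ρ φ i p.1 p.2.1 p.2.2) S := by
  have h1 : ContinuousOn (fun p : ℝ × ℝ × ℝ => Lambda lam i p.2.2) S :=
    hΛ.comp (by fun_prop) fun p hp => (hS p hp).2.1
  have h2 : ContinuousOn (fun p : ℝ × ℝ × ℝ => Lambda lam i (T - p.1 + p.2.2)) S :=
    hΛ.comp (f := fun p : ℝ × ℝ × ℝ => T - p.1 + p.2.2) (by fun_prop) fun p hp => by
      obtain ⟨a, b, -⟩ := hS p hp
      simp only [mem_Ioi]; linarith [a.2]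
  have h3 : ContinuousOn (fun p : ℝ × ℝ × ℝ => φ p.1 (exp p.2.1) i p.2.2) S :=
    hφ.comp (f := fun p : ℝ × ℝ × ℝ => (p.1, exp p.2.1, p.2.2)) (by fun_prop) fun p hp =>
      ⟨(hS p hp).1, (exp_pos _).le, (hS p hp).2.1.le, (hS p hp).2.2⟩
  have h4 : ContinuousOn (fun p : ℝ × ℝ × ℝ => ρ i p.1 (exp p.2.1)) S :=
    hρ.comp (f := fun p : ℝ × ℝ × ℝ => (p.1, exp p.2.1)) (by fun_prop) fun p hp =>
      ⟨(hS p hp).1, (exp_pos _).le⟩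
  have h0 : ContinuousOn (fun p : ℝ × ℝ × ℝ => exp (-(r i * p.1))) S := by fun_prop
  exact ((h0.mul h1.neg.rexp).mul h3).sub ((h0.mul h2.neg.rexp).mul h4)

theorem continuousOn_jumpSource {S : Set (ℝ × ℝ × ℝ)} (hS : ∀ p ∈ S, p.1 ∈ Icc 0 T ∧ 0 < p.2.2)
    (hΛ : ContinuousOn (Lambda lam i) (Ioi 0))
    (hlam : ∀ j, i ≠ j → ContinuousOn (lam i j) (Ioi 0))
    (hφ : ∀ j, ContinuousOn (fun p : ℝ × ℝ × ℝ => φ p.1 p.2.1 j p.2.2)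
      {p : ℝ × ℝ × ℝ | memDbar T p.1 p.2.1 p.2.2}) :
    ContinuousOn (fun p : ℝ × ℝ × ℝ => jumpSource lam r φ i p.1 p.2.1 p.2.2) S := by
  have h1 : ContinuousOn (fun p : ℝ × ℝ × ℝ => Lambda lam i p.2.2) S :=
    hΛ.comp (by fun_prop) fun p hp => (hS p hp).2
  unfold jumpSource
  refine ContinuousOn.mul (by fun_prop) (continuousOn_finsetSum _ fun j hj => ?_)
  refine ContinuousOn.mul ((hlam j (Finset.mem_filter.1 hj).2.symm).comp (by fun_prop)
    fun p hp => (hS p hp).2) ?_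
  exact (hφ j).comp (f := fun p : ℝ × ℝ × ℝ => (p.1, exp p.2.1, (0 : ℝ))) (by fun_prop)
    fun p hp => ⟨(hS p hp).1, (exp_pos _).le, le_rfl, (hS p hp).1.1⟩

theorem one_add_exp_le (z : ℝ) : 1 + exp z ≤ 2 * exp |z| := by
  have h1 : 1 ≤ exp |z| := one_le_exp (abs_nonneg z)
  have h2 : exp z ≤ exp |z| := exp_le_exp.2 (le_abs_self z)
  linarith

theorem abs_discountedGap_le (hr : 0 ≤ r i) (hΛ : ∀ y, 0 ≤ y → 0 ≤ Lambda lam i y)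
    (hM : 0 ≤ M)
    (hφ : ∀ t s y : ℝ, memDbar T t s y → |φ t s i y| ≤ M * (1 + s))
    (hρ : ∀ t ∈ Icc (0 : ℝ) T, ∀ s ∈ Ici (0 : ℝ), |ρ i t s| ≤ M * (1 + s))
    {t y : ℝ} (ht : t ∈ Icc 0 T) (hy : y ∈ Icc 0 t) (z : ℝ) :
    |discountedGap lam r T ρ φ i t z y| ≤ 4 * M * exp |z| := by
  have e0 : exp (-(r i * t)) ≤ 1 := exp_le_one_iff.2 (by nlinarith [ht.1])
  have e1 : exp (-Lambda lam i y) ≤ 1 := exp_le_one_iff.2 (by linarith [hΛ y hy.1])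
  have e2 : exp (-Lambda lam i (T - t + y)) ≤ 1 :=
    exp_le_one_iff.2 (by linarith [hΛ (T - t + y) (by linarith [hy.1, ht.2])])
  have key : ∀ {a b x : ℝ}, 0 < a → 0 < b → a ≤ 1 → b ≤ 1 → |x| ≤ M * (1 + exp z) →
      |a * b * x| ≤ 2 * M * exp |z| := by
    intro a b x ha hb ha1 hb1 hx
    rw [abs_mul, abs_of_pos (mul_pos ha hb)]
    calc a * b * |x| ≤ 1 * (M * (1 + exp z)) := by
          gcongr
          exact mul_le_one₀ ha1 hb.le hb1
      _ ≤ 1 * (M * (2 * exp |z|)) := by gcongr; exact one_add_exp_le z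
      _ = _ := by ring
  have k1 := key (exp_pos _) (exp_pos _) e0 e1 (hφ t _ y ⟨ht, (exp_pos z).le, hy⟩)
  have k2 := key (exp_pos _) (exp_pos _) e0 e2 (hρ t ht _ (exp_pos z).le)
  refine (abs_sub _ _).trans ?_
  linarith

theorem abs_jumpSource_le (hr : 0 ≤ r i) (hΛ : ∀ y, 0 ≤ y → 0 ≤ Lambda lam i y)
    (hnn : ∀ j, i ≠ j → ∀ y, 0 < y → 0 ≤ lam i j y)
    (hbound : ∀ y, 0 < y → sumLam lam i y ≤ c) (hM : 0 ≤ M)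
    (hφ : ∀ t s y : ℝ, memDbar T t s y → ∀ j, |φ t s j y| ≤ M * (1 + s))
    {t y : ℝ} (ht : t ∈ Icc 0 T) (hy : 0 < y) (z : ℝ) :
    |jumpSource lam r φ i t z y| ≤ 2 * c * M * exp |z| := by
  have e0 : exp (-(r i * t)) ≤ 1 := exp_le_one_iff.2 (by nlinarith [ht.1])
  have e1 : exp (-Lambda lam i y) ≤ 1 := exp_le_one_iff.2 (by linarith [hΛ y hy.le])
  have hs : |∑ j ∈ Finset.univ.filter (fun j => j ≠ i), lam i j y * φ t (exp z) j 0|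
      ≤ c * (M * (2 * exp |z|)) := by
    calc _ ≤ ∑ j ∈ Finset.univ.filter (fun j => j ≠ i), lam i j y * (M * (2 * exp |z|)) := by
          refine (Finset.abs_sum_le_sum_abs _ _).trans (Finset.sum_le_sum fun j hj => ?_)
          have h0 := hnn j (Finset.mem_filter.1 hj).2.symm y hy
          rw [abs_mul, abs_of_nonneg h0]
          gcongr
          refine (hφ t _ 0 ⟨ht, (exp_pos z).le, le_rfl, ht.1⟩ j).trans ?_
          gcongr
          exact one_add_exp_le z
      _ = sumLam lam i y * (M * (2 * exp |z|)) := by rw [sumLam, Finset.sum_mul]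
      _ ≤ _ := by gcongr; exact hbound y hy
  rw [jumpSource, abs_mul, abs_of_pos (mul_pos (exp_pos _) (exp_pos _))]
  calc _ ≤ 1 * (c * (M * (2 * exp |z|))) := by
        gcongr
        exact mul_le_one₀ e0 (exp_pos _).le e1
    _ = _ := by ring

end representation

section hedge

variable {k : ℕ} {lam : Fin k → Fin k → ℝ → ℝ} {i : Fin k} {c T M : ℝ} {r : Fin k → ℝ}
  {σ : ℝ → Fin k → ℝ} {φ : ℝ → ℝ → Fin k → ℝ → ℝ}

theorem integral_jumpSource_mul_gaussianReal
    (hnn : ∀ j, i ≠ j → ∀ y, 0 < y → 0 ≤ lam i j y)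
    (hφcont : ∀ j, ContinuousOn (fun p : ℝ × ℝ × ℝ => φ p.1 p.2.1 j p.2.2)
      {p : ℝ × ℝ × ℝ | memDbar T p.1 p.2.1 p.2.2})
    (hM : 0 ≤ M) (hφ : ∀ t s y : ℝ, memDbar T t s y → ∀ j, |φ t s j y| ≤ M * (1 + s))
    {t s y v : ℝ} (hs : 0 < s) (hv : 0 < y + v) (htv : t + v ∈ Icc 0 T)
    (hb : 0 < sigbar σ t i v) :
    ∫ ξ, jumpSource lam r φ i (t + v)
        (log s + (∫ u in t..(t + v), (r i - σ u i ^ 2 / 2)) + sigbar σ t i v * ξ) (y + v)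
          * (ξ / sigbar σ t i v) ∂(ProbabilityTheory.gaussianReal 0 1)
      = s * (exp (-(r i * t)) * exp (-Lambda lam i y))
        * (exp (-(r i * v)) * (fdens lam i (y + v) / (1 - Fcdf lam i y))
          * ∑ j ∈ Finset.univ.filter (fun j => j ≠ i), pMat lam i j (y + v)
            * ∫ x in Ioi (0 : ℝ), φ (t + v) x j 0 * alphaDens r σ x t s i v
                * (Lfun r σ t x s i v / (s * sigbar σ t i v))) := by
  set b := sigbar σ t i v with hbdef
  set x₀ := log s + ∫ u in t..(t + v), (r i - σ u i ^ 2 / 2) with hx₀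
  have hint : ∀ j, Integrable (fun ξ => φ (t + v) (exp (x₀ + b * ξ)) j 0 * ξ)
      (ProbabilityTheory.gaussianReal 0 1) := by
    intro j
    refine integrable_comp_add_mul_mul_gaussianReal (g := fun z => φ (t + v) (exp z) j 0)
      (C := 2 * M) ?_ (fun z => ?_) x₀ b
    · rw [← continuousOn_univ]
      exact (hφcont j).comp (f := fun z : ℝ => (t + v, exp z, (0 : ℝ))) (by fun_prop)
        fun z _ => ⟨htv, (exp_pos z).le, le_rfl, htv.1⟩
    · refine (hφ _ _ 0 ⟨htv, (exp_pos z).le, le_rfl, htv.1⟩ j).trans ?_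
      have h1 := one_add_exp_le z
      have h2 : exp |z| ≤ exp (2 * |z|) := exp_le_exp.2 (by linarith [abs_nonneg z])
      nlinarith [exp_two_abs_le_expWeight z]
  have hterm : ∀ j, ∫ x in Ioi (0 : ℝ), φ (t + v) x j 0 * alphaDens r σ x t s i v
        * (Lfun r σ t x s i v / (s * b))
      = (s * b)⁻¹ * ∫ ξ, φ (t + v) (exp (x₀ + b * ξ)) j 0 * ξ
          ∂(ProbabilityTheory.gaussianReal 0 1) := by
    intro j
    have h := integral_lognormal_eq (g := fun x => φ (t + v) x j 0) (k := fun ξ => ξ / (s * b))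
      (M := ∫ u in t..(t + v), (r i - σ u i ^ 2 / 2)) hs hb
    rw [← integral_const_mul]
    refine h.trans (integral_congr_ae (Eventually.of_forall fun ξ => ?_))
    simp only [hx₀]
    ring
  have hexp : exp (-(r i * (t + v))) = exp (-(r i * t)) * exp (-(r i * v)) := by
    rw [← exp_add]; ring_nf
  calc _ = ∫ ξ, ∑ j ∈ Finset.univ.filter (fun j => j ≠ i),
        (exp (-(r i * (t + v))) * exp (-Lambda lam i (y + v)) * lam i j (y + v) / b)
          * (φ (t + v) (exp (x₀ + b * ξ)) j 0 * ξ) ∂(ProbabilityTheory.gaussianReal 0 1) := by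
        refine integral_congr_ae (Eventually.of_forall fun ξ => ?_)
        simp only [jumpSource]
        rw [Finset.mul_sum, Finset.sum_mul]
        exact Finset.sum_congr rfl fun j _ => by ring
    _ = ∑ j ∈ Finset.univ.filter (fun j => j ≠ i),
        (exp (-(r i * (t + v))) * exp (-Lambda lam i (y + v)) * lam i j (y + v) / b)
          * ∫ ξ, φ (t + v) (exp (x₀ + b * ξ)) j 0 * ξ ∂(ProbabilityTheory.gaussianReal 0 1) := by
        rw [integral_finsetSum _ fun j _ => (hint j).const_mul _]
        simp only [integral_const_mul]
    _ = _ := by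
        simp only [Finset.mul_sum]
        refine Finset.sum_congr rfl fun j hj => ?_
        have hp := fdens_mul_pMat hnn (Finset.mem_filter.1 hj).2 hv
        rw [hterm, one_sub_Fcdf, hexp]
        have hE := exp_pos (-Lambda lam i y)
        generalize ∫ ξ, φ (t + v) (exp (x₀ + b * ξ)) j 0 * ξ
          ∂(ProbabilityTheory.gaussianReal 0 1) = I
        have h1 : exp (-(r i * t)) * exp (-(r i * v)) * exp (-Lambda lam i (y + v))
            * lam i j (y + v) / b * I
            = exp (-(r i * t)) * exp (-(r i * v)) * (fdens lam i (y + v) * pMat lam i j (y + v))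
              / b * I := by rw [hp]; ring
        rw [h1]
        field_simp

theorem continuous_jumpSource_clip {t₁ a : ℝ} (h0 : 0 ≤ t₁) (ha : a < t₁) (h1T : t₁ ≤ T)
    (hΛ : ContinuousOn (Lambda lam i) (Ioi 0))
    (hlam : ∀ j, i ≠ j → ContinuousOn (lam i j) (Ioi 0))
    (hφ : ∀ j, ContinuousOn (fun p : ℝ × ℝ × ℝ => φ p.1 p.2.1 j p.2.2)
      {p : ℝ × ℝ × ℝ | memDbar T p.1 p.2.1 p.2.2}) :
    Continuous fun p : ℝ × ℝ =>
      jumpSource lam r φ i (max t₁ (min T p.1)) p.2 (max t₁ (min T p.1) - a) := by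
  rw [← continuousOn_univ]
  refine (continuousOn_jumpSource (S := {p | p.1 ∈ Icc 0 T ∧ 0 < p.2.2}) (fun p hp => hp)
    hΛ hlam hφ).comp
      (f := fun p : ℝ × ℝ => (max t₁ (min T p.1), p.2, max t₁ (min T p.1) - a))
      (by fun_prop) fun p _ => ?_
  have := le_max_left t₁ (min T p.1)
  exact ⟨⟨by linarith, max_le h1T (min_le_left _ _)⟩, show 0 < _ - a by linarith⟩

end hedge

theorem stmt_15 {k : ℕ} (lam : Fin k → Fin k → ℝ → ℝ)
    (hmeas : ∀ i j : Fin k, i ≠ j → Measurable (lam i j))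
    (hnn : ∀ i j : Fin k, i ≠ j → ∀ y : ℝ, 0 < y → 0 ≤ lam i j y)
    (c : ℝ) (hc : 0 < c)
    (hbound : ∀ i : Fin k, ∀ y : ℝ, 0 < y → sumLam lam i y ≤ c)
    (hinf : ∀ i : Fin k, Tendsto (Lambda lam i) atTop atTop)
    (r : Fin k → ℝ) (hr : ∀ i : Fin k, 0 ≤ r i)
    (σ : ℝ → Fin k → ℝ)
    (hσpos : ∀ u : ℝ, 0 ≤ u → ∀ i : Fin k, 0 < σ u i)
    (hσcont : ∀ i : Fin k, ContinuousOn (fun u => σ u i) (Set.Ici 0))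
    (T : ℝ) (hT : 0 < T)
    (K : ℝ → ℝ) (hKcont : ContinuousOn K (Set.Ici 0))
    (k₁ k₂ : ℝ) (hk₁ : 0 < k₁) (hk₂ : 0 < k₂)
    (hK : ∀ s : ℝ, 0 ≤ s → 0 ≤ K s ∧ K s ≤ k₁ + k₂ * s)
    (ρ : Fin k → ℝ → ℝ → ℝ) (hρ : isBSMSolution r σ K T ρ)
    (hdiff : ∀ i j : Fin k, i ≠ j → ∀ y : ℝ, 0 < y → DifferentiableAt ℝ (lam i j) y)
    (hirr : ∀ i j : Fin k, ∃ n : ℕ, 1 ≤ n ∧ 0 < (ptilde lam ^ n) i j)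
    (φ : ℝ → ℝ → Fin k → ℝ → ℝ)
    -- φ is the (unique) classical solution of (P) of at most linear growth :
    (hφcont : ∀ i : Fin k, ContinuousOn (fun p : ℝ × ℝ × ℝ => φ p.1 p.2.1 i p.2.2)
      {p : ℝ × ℝ × ℝ | memDbar T p.1 p.2.1 p.2.2})
    (hφdiff : ∀ i : Fin k, ∀ t s y : ℝ, memD T t s y →
      DifferentiableAt ℝ (fun u => φ u s i y) t ∧
      DifferentiableAt ℝ (fun x => φ t x i y) s ∧
      DifferentiableAt ℝ (deriv (fun x => φ t x i y)) s ∧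
      DifferentiableAt ℝ (fun w => φ t s i w) y)
    (hφPDE : ∀ i : Fin k, ∀ t s y : ℝ, memD T t s y →
      deriv (fun u => φ u s i y) t + deriv (fun w => φ t s i w) y
        + r i * s * deriv (fun x => φ t x i y) s
        + (1/2) * (σ t i)^2 * s^2 * deriv (deriv (fun x => φ t x i y)) s
        + ∑ j ∈ Finset.univ.filter (fun j => j ≠ i),
            lam i j y * (φ t s j 0 - φ t s i y)
        = r i * φ t s i y)
    (hφterm : ∀ i : Fin k, ∀ s : ℝ, 0 < s → ∀ y ∈ Set.Icc (0:ℝ) T, φ T s i y = K s)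
    (hφgrow : ∃ M : ℝ, ∀ t s y : ℝ, memDbar T t s y → ∀ i : Fin k,
      |φ t s i y| ≤ M * (1 + s)) :
    ∀ i : Fin k, ∀ t s y : ℝ, memD T t s y →
      deriv (fun x => φ t x i y) s
        = (1 - Fcdf lam i (T - t + y)) / (1 - Fcdf lam i y)
            * deriv (fun x => ρ i t x) s
          + ∫ v in (0:ℝ)..(T - t),
              Real.exp (-(r i * v)) * (fdens lam i (y + v) / (1 - Fcdf lam i y)) *
              ∑ j ∈ Finset.univ.filter (fun j => j ≠ i),
                pMat lam i j (y + v) *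
                ∫ x in Set.Ioi (0:ℝ),
                  φ (t + v) x j 0 * alphaDens r σ x t s i v *
                    (Lfun r σ t x s i v / (s * sigbar σ t i v)) := by
  intro i t s y hD
  obtain ⟨ht, hs, hy⟩ := id hD
  rw [mem_Ioi] at hs
  obtain ⟨M₁, hM₁⟩ := hφgrow
  obtain ⟨hρcont, hρnn, ⟨M₂, hM₂⟩, hρPDE, hρterm⟩ := hρ i
  obtain ⟨M, hM, hM1, hM2⟩ : ∃ M : ℝ, 0 ≤ M ∧ M₁ ≤ M ∧ M₂ ≤ M :=
    ⟨max 0 (max M₁ M₂), le_max_left _ _, (le_max_left _ _).trans (le_max_right _ _),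
      (le_max_right _ _).trans (le_max_right _ _)⟩
  have hφM : ∀ t s y : ℝ, memDbar T t s y → ∀ j : Fin k, |φ t s j y| ≤ M * (1 + s) :=
    fun t s y h j => (hM₁ t s y h j).trans
      (mul_le_mul_of_nonneg_right hM1 (by linarith [mem_Ici.1 h.2.1]))
  have hρM : ∀ t ∈ Icc (0 : ℝ) T, ∀ s ∈ Ici (0 : ℝ), |ρ i t s| ≤ M * (1 + s) := by
    intro t ht s hs
    rw [abs_of_nonneg (hρnn t ht s hs)]
    exact (hM₂ t ht s hs).trans (mul_le_mul_of_nonneg_right hM2 (by linarith [mem_Ici.1 hs]))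
  have hmeas' := hmeas i
  have hnn' := hnn i
  have hΛd : ∀ y, 0 < y → HasDerivAt (Lambda lam i) (sumLam lam i y) y :=
    fun y hy => hasDerivAt_Lambda hmeas' hnn' (hbound i) (hdiff i) hy
  have hΛc : ContinuousOn (Lambda lam i) (Ioi 0) :=
    fun y hy => (hΛd y hy).continuousAt.continuousWithinAt
  have hΛ0 : ∀ y, 0 ≤ y → 0 ≤ Lambda lam i y := fun y hy => Lambda_nonneg hnn' hy
  have hlamc : ∀ j, i ≠ j → ContinuousOn (lam i j) (Ioi 0) :=
    fun j hj y hy => (hdiff i j hj y hy).continuousAt.continuousWithinAt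
  -- coefficients extended continuously to the real line
  set τ : ℝ → ℝ := fun u => σ (max u 0) i with hτ
  set m : ℝ → ℝ := fun u => r i - τ u ^ 2 / 2 with hm
  have hτc : Continuous τ := by
    rw [← continuousOn_univ]
    exact (hσcont i).comp (f := fun u : ℝ => max u 0) (by fun_prop) fun u _ => le_max_right u 0
  have hmc : Continuous m := by fun_prop
  have hτσ : ∀ u, 0 ≤ u → τ u = σ u i := fun u hu => by rw [hτ]; simp only [max_eq_left hu]
  have hbar : ∀ v, 0 ≤ v → √(∫ u in t..(t + v), τ u ^ 2) = sigbar σ t i v := by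
    intro v hv
    rw [sigbar]
    congr 1
    refine intervalIntegral.integral_congr fun u hu => ?_
    rw [uIcc_of_le (by linarith)] at hu
    simp only [hτσ u (ht.1.le.trans hu.1)]
  have hdrift : ∀ v, 0 ≤ v →
      ∫ u in t..(t + v), m u = ∫ u in t..(t + v), (r i - σ u i ^ 2 / 2) := by
    intro v hv
    refine intervalIntegral.integral_congr fun u hu => ?_
    rw [uIcc_of_le (by linarith)] at hu
    simp only [hm, hτσ u (ht.1.le.trans hu.1)]
  have hbarpos : ∀ v, 0 < v → 0 < sigbar σ t i v := by
    intro v hv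
    rw [← hbar v hv.le]
    refine sqrt_pos.2 (intervalIntegral.intervalIntegral_pos_of_pos_on
      ((hτc.pow 2).intervalIntegrable _ _) (fun u hu => ?_) (by linarith))
    exact pow_pos (hσpos _ (le_max_right _ _) i) 2
  obtain ⟨b₀, hb₀, hb₀τ⟩ : ∃ b₀, 0 < b₀ ∧ ∀ u ∈ Icc t T, b₀ ≤ τ u := by
    obtain ⟨u, -, hu⟩ := isCompact_Icc.exists_isMinOn (nonempty_Icc.2 ht.2.le)
      (hτc.continuousOn (s := Icc t T))
    exact ⟨τ u, hσpos _ (le_max_right _ _) i, fun v hv => hu hv⟩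
  -- the tube around the characteristic line through `(t, y)`
  set a := t - y with ha
  set t₁ := t - y / 4 with ht₁
  set η := min (y / 4) (a / 2) with hη
  have ha0 : 0 < a := by linarith [hy.2]
  have hη0 : 0 < η := lt_min (by linarith [hy.1]) (by linarith)
  have hη1 : η ≤ y / 4 := min_le_left _ _
  have hη2 : η ≤ a / 2 := min_le_right _ _
  have hy0 := hy.1
  have ht₁0 : 0 < t₁ := by linarith [hy.2]
  have htube : ∀ u w, t₁ ≤ u → |u - w - a| ≤ η → 0 < w ∧ w < u := by
    intro u w hu hw
    rw [abs_le] at hw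
    constructor <;> linarith [hw.1, hw.2]
  have htube' : ∀ p ∈ {p : ℝ × ℝ × ℝ | p.1 ∈ Icc t₁ T ∧ |p.1 - p.2.2 - a| ≤ η},
      p.1 ∈ Icc 0 T ∧ 0 < p.2.2 ∧ p.2.2 ≤ p.1 := by
    rintro ⟨u, x, w⟩ ⟨hu, hw⟩
    obtain ⟨h1, h2⟩ := htube u w hu.1 hw
    exact ⟨⟨ht₁0.le.trans hu.1, hu.2⟩, h1, h2.le⟩
  set V := discountedGap lam r T ρ φ i with hV
  set H := jumpSource lam r φ i with hH
  set G : ℝ → ℝ → ℝ := fun u z => H (max t₁ (min T u)) z (max t₁ (min T u) - a) with hG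
  have hGc : Continuous fun p : ℝ × ℝ => G p.1 p.2 :=
    continuous_jumpSource_clip ht₁0.le (by linarith) (by linarith [ht.2]) hΛc hlamc hφcont
  have hGH : ∀ u ∈ Icc t₁ T, ∀ z, G u z = H u z (u - a) := by
    intro u hu z
    simp only [hG, min_eq_right hu.2, max_eq_right hu.1]
  have hHg : ∀ u z w, u ∈ Icc t₁ T → |u - w - a| ≤ η →
      |H u z w| ≤ (4 * M + 2 * c * M) * exp |z| := by
    intro u z w hu hw
    refine (abs_jumpSource_le (hr i) hΛ0 hnn' (hbound i) hM hφM
      ⟨ht₁0.le.trans hu.1, hu.2⟩ (htube u w hu.1 hw).1 z).trans ?_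
    exact mul_le_mul_of_nonneg_right (by linarith) (exp_pos _).le
  have hrep : ∀ z, V t z y = ∫ p, G p.1 (gaussPoint m τ t z p.1 p.2) ∂timeGauss t T := by
    intro z
    have h := eq_integral_gaussPoint (V := V) (H := H) (G := G) (a := a)
      (C := 4 * M + 2 * c * M) hmc hτc (t₁ := t₁) (t₀ := t) (by linarith) ht.2 hη0
      (continuousOn_discountedGap htube' hΛc hρcont (hφcont i))
      (fun u z w hu hw => by
        obtain ⟨h1, h2⟩ := htube u w hu.1 hw
        refine (abs_discountedGap_le (hr i) hΛ0 hM (fun t s y h => hφM t s y h i) hρM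
          ⟨ht₁0.le.trans hu.1, hu.2⟩ ⟨h1.le, h2.le⟩ z).trans ?_
        exact mul_le_mul_of_nonneg_right (le_add_of_nonneg_right (by positivity)) (exp_pos _).le)
      (fun z w hw => by
        obtain ⟨h1, h2⟩ := htube T w (by linarith [ht.2]) hw
        simp only [hV, discountedGap, sub_self, zero_add]
        rw [hφterm i _ (exp_pos z) w ⟨h1.le, h2.le⟩, hρterm _ (exp_pos z).le, sub_self])
      (continuousOn_jumpSource (fun p hp => ⟨(htube' p hp).1, (htube' p hp).2.1⟩) hΛc hlamc hφcont)
      hHg hGc hGH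
      (fun u z w hu hw => by
        obtain ⟨h1, h2⟩ := htube u w hu.1.le hw.le
        have hg := hasGenAt_discountedGap hΛd hρPDE (hφdiff i) (hφPDE i)
          ⟨ht₁0.trans hu.1, hu.2⟩ ⟨h1, h2⟩ z
        simp only [hm, hτσ u (ht₁0.trans hu.1).le]
        exact hg) z
    rwa [ha, sub_sub_cancel] at h
  have hJ := hasDerivAt_integral_gaussPoint (C := 4 * M + 2 * c * M) hmc hτc ht.2.le hb₀ hb₀τ hGc
    (fun u hu z => by
      have hu' : u ∈ Icc t₁ T := ⟨by linarith [hu.1], hu.2⟩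
      rw [hGH u hu' z]
      refine (hHg u z (u - a) hu' (by simpa using hη0.le)).trans
        (mul_le_mul_of_nonneg_left ?_ (by positivity))
      exact (exp_le_exp.2 (by linarith [abs_nonneg z])).trans (exp_two_abs_le_expWeight z))
    (log s)
  simp only [← hrep] at hJ
  -- the derivative of the Gaussian integral in the original variables
  have hval : (∫ u in t..T, ∫ ξ, G u (gaussPoint m τ t (log s) u ξ)
        * (ξ / √(∫ v in t..u, τ v ^ 2)) ∂(ProbabilityTheory.gaussianReal 0 1))
      = s * (exp (-(r i * t)) * exp (-Lambda lam i y)) * ∫ v in (0:ℝ)..(T - t),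
          exp (-(r i * v)) * (fdens lam i (y + v) / (1 - Fcdf lam i y)) *
            ∑ j ∈ Finset.univ.filter (fun j => j ≠ i), pMat lam i j (y + v) *
              ∫ x in Set.Ioi (0:ℝ), φ (t + v) x j 0 * alphaDens r σ x t s i v *
                (Lfun r σ t x s i v / (s * sigbar σ t i v)) := by
    rw [← intervalIntegral.integral_const_mul]
    have hsub := intervalIntegral.integral_comp_add_left (a := 0) (b := T - t)
      (fun u => ∫ ξ, G u (gaussPoint m τ t (log s) u ξ)
        * (ξ / √(∫ v in t..u, τ v ^ 2)) ∂(ProbabilityTheory.gaussianReal 0 1)) t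
    rw [add_zero, add_sub_cancel] at hsub
    rw [← hsub]
    refine intervalIntegral.integral_congr_ae (Eventually.of_forall fun v hv => ?_)
    rw [uIoc_of_le (by linarith [ht.2])] at hv
    have hv0 := hv.1
    have hvT := hv.2
    have hkey := integral_jumpSource_mul_gaussianReal (r := r) (t := t) hnn' hφcont hM hφM hs
      (show 0 < y + v by linarith) (show t + v ∈ Icc 0 T from ⟨by linarith [ht.1], by linarith⟩)
      (hbarpos v hv0)
    rw [← hkey, hbar v hv0.le]
    refine integral_congr_ae (Eventually.of_forall fun ξ => ?_)
    simp only
    rw [hGH (t + v) ⟨by linarith, by linarith⟩, gaussPoint, hbar v hv0.le, hdrift v hv0.le,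
      show t + v - a = y + v by rw [ha]; ring]
  -- the derivative of `V` in the original variables
  have hφs := (hφdiff i t s y hD).2.1.hasDerivAt
  have hρs := (hρPDE t ht s hs).1.2.1.hasDerivAt
  have hd1 : HasDerivAt (fun x => exp (-(r i * t)) * exp (-Lambda lam i y) * φ t x i y
      - exp (-(r i * t)) * exp (-Lambda lam i (T - t + y)) * ρ i t x) _ s :=
    (hφs.const_mul _).sub (hρs.const_mul _)
  have hd2 := HasDerivAt.comp s hJ (hasDerivAt_log hs.ne')
  have hd3 : HasDerivAt (fun x => exp (-(r i * t)) * exp (-Lambda lam i y) * φ t x i y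
      - exp (-(r i * t)) * exp (-Lambda lam i (T - t + y)) * ρ i t x) _ s :=
    hd2.congr_of_eventuallyEq (by
      filter_upwards [lt_mem_nhds hs] with x hx
      simp only [Function.comp_apply, hV, discountedGap, exp_log hx])
  have heq := hd1.unique hd3
  rw [hval] at heq
  simp only [one_sub_Fcdf] at heq ⊢
  have hE := exp_pos (-Lambda lam i y)
  have hE' := exp_pos (-(r i * t))
  generalize intervalIntegral (E := ℝ) _ (0 : ℝ) (T - t) volume = I at heq ⊢
  field_simp at heq ⊢
  linear_combination heq
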